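/- arXiv:1109.4660 — 3 statements merged into one kernel-verified Lean document; each statement's English description precedes it below -/
import Mathlib

section
/- Let n, m be natural numbers and let a be a real number with a ≠ 0 and a ≠ 1. Then for every k with 0 ≤ k ≤ n+m, the linearization coefficient of the Bessel polynomials satisfies the single-sum formula β_k^{(n,m)}(a) = a^{2n+m−k} (1−a)^{k−n} · ((1/2)_{n+m−k} (1/2)_k)/((1/2)_n (1/2)_m) · Σ_{j=0}^{2(n+m−k)} (−1)^j C(n+m+1, 2n+2m−2k−j) C(k−m+j, j) a^{−j}, where the powers a^{2n+m−k}, (1−a)^{k−n}, a^{−j} are integer (possibly negative) powers of the nonzero real numbers a and 1−a, C(n+m+1, s) is the usual binomial coefficient (equal to 0 unless 0 ≤ s ≤ n+m+1), and C(k−m+j, j) is the generalized binomial coefficient with (possibly negative) integer upper entry. -/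
open Finset

/-- The Bessel polynomial `q_n`, normalized so that `q_n(0) = 1`. -/
noncomputable def besselQ (n : ℕ) (u : ℝ) : ℝ :=
  ∑ k ∈ Finset.range (n + 1),
    ((n.factorial : ℝ) * (2 * n - k).factorial * 2 ^ k) /
      ((2 * n).factorial * (n - k).factorial * k.factorial) * u ^ k

/-- The Pochhammer symbol `(x)_j = x (x+1) ⋯ (x+j-1)`. -/
noncomputable def poch (x : ℝ) (j : ℕ) : ℝ := ∏ i ∈ Finset.range j, (x + i)

/-- Generalized binomial coefficient with integer (possibly negative) upper entry. -/
noncomputable def gbinom (z : ℤ) (j : ℕ) : ℝ :=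
  (∏ i ∈ Finset.range j, ((z : ℝ) - i)) / j.factorial

/-- Generalized binomial coefficients with integer lower index. -/
noncomputable def GB (q s : ℤ) : ℝ := if 0 ≤ s then gbinom q s.toNat else 0

/-- Coefficient of `x^s` in `(1+a x)^p (1+x)^q`. -/
noncomputable def Ph (a : ℝ) : ℕ → ℤ → ℤ → ℝ
  | 0, q, s => GB q s
  | p + 1, q, s => Ph a p q s + a * Ph a p q (s - 1)

lemma gbinom_succ (q : ℤ) (j : ℕ) : ((j : ℝ) + 1) * gbinom q (j + 1) = (q - j) * gbinom q j := by
  unfold gbinom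
  rw [Finset.prod_range_succ, Nat.factorial_succ]
  have : (j.factorial : ℝ) ≠ 0 := by positivity
  have h2 : (j : ℝ) + 1 ≠ 0 := by positivity
  push_cast
  field_simp

lemma gbinom_zero (q : ℤ) : gbinom q 0 = 1 := by simp [gbinom]

lemma GB_nat (q : ℤ) (j : ℕ) : GB q j = gbinom q j := by simp [GB]

lemma GB_neg (q s : ℤ) (h : s < 0) : GB q s = 0 := by
  simp [GB, not_le.mpr h]

lemma GB_succ (q s : ℤ) : ((s : ℝ) + 1) * GB q (s + 1) = (q - s) * GB q s := by
  rcases lt_trichotomy s (-1) with h | h | h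
  · rw [GB_neg _ _ (by omega), GB_neg _ _ (by omega)]; simp
  · subst h
    rw [GB_neg _ (-1) (by omega)]; simp
  · obtain ⟨j, rfl⟩ := Int.eq_ofNat_of_zero_le (show 0 ≤ s by omega)
    have := gbinom_succ q j
    rw [← GB_nat, ← GB_nat] at this
    push_cast at this ⊢
    exact this

lemma gbinom_pascal (q : ℤ) (j : ℕ) : gbinom (q + 1) (j + 1) = gbinom q (j + 1) + gbinom q j := by
  induction j with
  | zero =>
    have h1 := gbinom_succ (q + 1) 0
    have h2 := gbinom_succ q 0
    simp [gbinom_zero] at *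
    linarith
  | succ j ih =>
    have h1 := gbinom_succ (q + 1) (j + 1)
    have h2 := gbinom_succ q (j + 1)
    have h3 := gbinom_succ q j
    have h0 : ((j : ℝ) + 1 + 1) ≠ 0 := by positivity
    apply mul_left_cancel₀ h0
    rw [ih] at h1
    push_cast at *
    linear_combination h1 - h2 - h3

lemma GB_pascal (q s : ℤ) : GB (q + 1) s = GB q s + GB q (s - 1) := by
  rcases lt_trichotomy s 0 with h | h | h
  · rw [GB_neg _ _ h, GB_neg _ _ h, GB_neg _ _ (by omega)]; simp
  · subst h
    rw [GB_neg _ (0 - 1) (by omega)]; simp [GB, gbinom_zero]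
  · obtain ⟨j, hj⟩ := Int.eq_ofNat_of_zero_le (show 0 ≤ s - 1 by omega)
    obtain rfl : s = ((j + 1 : ℕ) : ℤ) := by push_cast; omega
    rw [hj, GB_nat, GB_nat, GB_nat, gbinom_pascal]

lemma gbinom_neg (q : ℤ) (j : ℕ) : gbinom q j = (-1) ^ j * gbinom (j - 1 - q) j := by
  unfold gbinom
  rw [← Finset.prod_range_reflect (fun i : ℕ => (((j - 1 - q : ℤ) : ℝ) - i)), ← mul_div_assoc]
  congr 1
  have hj : (-1 : ℝ) ^ j = ∏ _i ∈ range j, (-1 : ℝ) := by simp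
  rw [hj, ← Finset.prod_mul_distrib]
  apply Finset.prod_congr rfl
  intro i hi
  have := Finset.mem_range.mp hi
  rw [Nat.cast_sub (by omega), Nat.cast_sub (by omega)]
  push_cast
  ring

lemma GB_reflect (q s : ℤ) : GB q s = (-1) ^ s * GB (s - 1 - q) s := by
  rcases lt_or_ge s 0 with h | h
  · rw [GB_neg _ _ h, GB_neg _ _ h]; simp
  · obtain ⟨j, rfl⟩ := Int.eq_ofNat_of_zero_le h
    have := gbinom_neg q j
    rw [GB_nat, GB_nat, this]; simp

lemma GB_vanish (q : ℕ) (s : ℤ) (h : (q : ℤ) < s) : GB q s = 0 := by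
  obtain ⟨j, rfl⟩ := Int.eq_ofNat_of_zero_le (show 0 ≤ s by omega)
  rw [GB_nat]
  unfold gbinom
  rw [Finset.prod_eq_zero (i := q)]
  · simp
  · simp; omega
  · simp

lemma Ph_neg (a : ℝ) (p : ℕ) (q s : ℤ) (h : s < 0) : Ph a p q s = 0 := by
  induction p generalizing s with
  | zero => exact GB_neg _ _ h
  | succ p ih => simp [Ph, ih s h, ih (s - 1) (by omega)]

lemma Ph_zero (a : ℝ) (p : ℕ) (q : ℤ) : Ph a p q 0 = 1 := by
  induction p with
  | zero => simp [Ph, GB, gbinom_zero]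
  | succ p ih => simp [Ph, ih, Ph_neg]

lemma Ph_vanish (a : ℝ) (p q : ℕ) (s : ℤ) (h : (p : ℤ) + q < s) : Ph a p q s = 0 := by
  induction p generalizing s with
  | zero => exact GB_vanish _ _ (by simpa using h)
  | succ p ih =>
    push_cast at h
    simp [Ph, ih s (by omega), ih (s - 1) (by omega)]

lemma Ph_pascal (a : ℝ) (p : ℕ) (q s : ℤ) : Ph a p (q + 1) s = Ph a p q s + Ph a p q (s - 1) := by
  induction p generalizing s with
  | zero => exact GB_pascal _ _
  | succ p ih => simp only [Ph, ih]; ring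

lemma Ph_reflect (a : ℝ) (p : ℕ) (q s : ℤ) :
    Ph a p q s = (-1) ^ s * Ph (1 - a) p (s - 1 - p - q) s := by
  induction p generalizing q s with
  | zero => simpa [Ph] using GB_reflect q s
  | succ p ih =>
    have h1 : Ph a p q s = Ph a p (q + 1) s - Ph a p q (s - 1) := by rw [Ph_pascal]; ring
    have hs : (-1 : ℝ) ^ s = - (-1) ^ (s - 1) := by
      rw [zpow_sub_one₀ (by norm_num)]; ring
    rw [Ph, h1, ih (q + 1) s, ih q (s - 1), Ph]
    have e1 : s - 1 - (p : ℤ) - (q + 1) = s - 1 - ((p + 1 : ℕ) : ℤ) - q := by push_cast; ring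
    have e2 : s - 1 - 1 - (p : ℤ) - q = s - 1 - ((p + 1 : ℕ) : ℤ) - q := by push_cast; ring
    rw [e1, e2, hs]
    ring

lemma Ph_ode (a : ℝ) (p : ℕ) (q s : ℤ) :
    ((s : ℝ) + 1) * Ph a p q (s + 1) + (1 + a) * s * Ph a p q s + a * (s - 1) * Ph a p q (s - 1)
      = (p * a + q) * Ph a p q s + a * (p + q) * Ph a p q (s - 1) := by
  induction p generalizing s with
  | zero =>
    simp only [Ph]
    have h1 := GB_succ q s
    have h2 := GB_succ q (s - 1)
    rw [sub_add_cancel] at h2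
    push_cast at *
    linear_combination h1 + a * h2
  | succ p ih =>
    simp only [Ph]
    have h1 := ih s
    have h2 := ih (s - 1)
    rw [sub_add_cancel] at h2
    rw [add_sub_cancel_right]
    push_cast at *
    linear_combination h1 + a * h2

lemma Ph_three (a : ℝ) (n : ℕ) (k : ℤ) (N : ℤ) (hN : N = n + 1 - k) :
    (2 * (N : ℝ) + 1) * (Ph a (n + 3) (-k - 1) (2 * N + 2) - Ph a (n + 1) (-k + 1) (2 * N + 2))
      = (1 - a) * ((2 * n + 3) * Ph a (n + 2) (-k - 1) (2 * N)
        - a * (2 * k + 1) * Ph a (n + 1) (-k) (2 * N)) := by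
  obtain ⟨z, hz⟩ : ∃ z, z = -k - 2 := ⟨_, rfl⟩
  have e1 : -k + 1 = z + 1 + 1 + 1 := by omega
  have e2 : -k = z + 1 + 1 := by omega
  have e3 : -k - 1 = z + 1 := by omega
  have hk : (k : ℝ) = - z - 2 := by
    have : k = - z - 2 := by omega
    rw [this]; push_cast; ring
  have hn : (n : ℝ) = N - z - 3 := by
    have : (n : ℤ) = N - z - 3 := by omega
    have h : ((n : ℤ) : ℝ) = ((N - z - 3 : ℤ) : ℝ) := by rw [this]
    push_cast at h; exact h
  rw [e1, e3, e2]
  simp only [Ph, Ph_pascal]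
  have h0 := Ph_ode a n z (2 * N)
  have h1 := Ph_ode a n z (2 * N - 1)
  have h2 := Ph_ode a n z (2 * N - 2)
  have t2 : 2 * N + 2 - 1 = 2 * N + 1 := by ring
  have t3 : 2 * N + 1 - 1 = 2 * N := by ring
  have t4 : 2 * N - 1 - 1 = 2 * N - 2 := by ring
  have t5 : 2 * N - 1 + 1 = 2 * N := by ring
  have t6 : 2 * N - 2 + 1 = 2 * N - 1 := by ring
  have t7 : 2 * N - 2 - 1 = 2 * N - 3 := by ring
  simp only [t2, t3, t4, t5, t6, t7] at *
  rw [hk]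
  rw [hn] at *
  push_cast at *
  linear_combination (-(1-a)) * (2 * h0 + 2 * (1 + a) * h1 + 2 * a * h2)

lemma Ph_sum (a : ℝ) (p : ℕ) (q s : ℤ) :
    Ph a p q s = ∑ i ∈ range (p + 1), (p.choose i : ℝ) * a ^ i * GB q (s - i) := by
  induction p generalizing s with
  | zero => simp [Ph]
  | succ p ih =>
    have h1 : Ph a p q s = ∑ i ∈ range (p + 2), (p.choose i : ℝ) * a ^ i * GB q (s - i) := by
      rw [ih, Finset.sum_range_succ _ (p + 1)]; simp
    rw [Ph, h1, ih, Finset.sum_range_succ' _ (p + 1), Finset.sum_range_succ' _ (p + 1),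
      Finset.mul_sum, add_right_comm, ← Finset.sum_add_distrib]
    simp only [Nat.choose_zero_right]
    congr 1
    apply Finset.sum_congr rfl
    intro i _
    rw [Nat.choose_succ_succ]
    have : s - 1 - (i : ℤ) = s - ((i + 1 : ℕ) : ℤ) := by push_cast; ring
    rw [this]
    push_cast
    ring

lemma Ph_sum_nat (a : ℝ) (p : ℕ) (q : ℤ) (s : ℕ) :
    Ph a p q s = ∑ j ∈ range (s + 1), (p.choose (s - j) : ℝ) * a ^ (s - j) * gbinom q j := by
  have h1 : Ph a p q s = ∑ i ∈ range (s + 1), (p.choose i : ℝ) * a ^ i * GB q (s - i) := by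
    rw [Ph_sum]
    rcases le_total p s with h | h
    · apply Finset.sum_subset (Finset.range_mono (by omega))
      intro i _ hi
      rw [Nat.choose_eq_zero_of_lt (by simpa using hi)]; simp
    · symm
      apply Finset.sum_subset (Finset.range_mono (by omega))
      intro i _ hi
      rw [GB_neg _ _ (by simp at hi; omega)]; simp
  rw [h1, ← Finset.sum_range_reflect]
  apply Finset.sum_congr rfl
  intro j hj
  have hj := Finset.mem_range.mp hj
  rw [show s + 1 - 1 - j = s - j by omega, ← GB_nat]
  congr 2
  omega
open Polynomial in
/-- Bessel polynomials through the three-term recurrence. -/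
noncomputable def QP : ℕ → ℝ[X]
  | 0 => 1
  | 1 => 1 + X
  | n + 2 => QP (n + 1) + C (1 / ((2 * n + 1) * (2 * n + 3) : ℝ)) * X ^ 2 * QP n

lemma alpha_rec (k d : ℕ) :
    (((k + d + 1 + 2).factorial : ℝ) * (2 * (k + d + 1 + 2) - (k + 2)).factorial * 2 ^ (k + 2)) /
      ((2 * (k + d + 1 + 2)).factorial * ((k + d + 1 + 2) - (k + 2)).factorial * (k + 2).factorial) =
    (((k + d + 1 + 1).factorial : ℝ) * (2 * (k + d + 1 + 1) - (k + 2)).factorial * 2 ^ (k + 2)) /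
      ((2 * (k + d + 1 + 1)).factorial * ((k + d + 1 + 1) - (k + 2)).factorial * (k + 2).factorial)
    + 1 / ((2 * (k + d + 1 : ℝ) + 1) * (2 * (k + d + 1) + 3)) *
    ((((k + d + 1).factorial : ℝ) * (2 * (k + d + 1) - k).factorial * 2 ^ k) /
      ((2 * (k + d + 1)).factorial * ((k + d + 1) - k).factorial * k.factorial)) := by
  rw [show 2 * (k + d + 1 + 2) - (k + 2) = k + 2 * d + 1 + 1 + 1 + 1 by omega,
    show k + d + 1 + 2 - (k + 2) = d + 1 by omega,
    show 2 * (k + d + 1 + 1) - (k + 2) = k + 2 * d + 1 + 1 by omega,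
    show k + d + 1 + 1 - (k + 2) = d by omega,
    show 2 * (k + d + 1) - k = k + 2 * d + 1 + 1 by omega,
    show k + d + 1 - k = d + 1 by omega,
    show 2 * (k + d + 1 + 2) = 2 * (k + d + 1) + 1 + 1 + 1 + 1 by omega,
    show 2 * (k + d + 1 + 1) = 2 * (k + d + 1) + 1 + 1 by omega,
    show k + d + 1 + 2 = k + d + 1 + 1 + 1 by omega]
  generalize hg : 2 * (k + d + 1) = g
  have hg' : (g : ℝ) = 2 * (k + d + 1) := by rw [← hg]; push_cast; ring
  simp only [Nat.factorial_succ]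
  push_cast
  rw [hg']
  have h1 : ((k + d).factorial : ℝ) ≠ 0 := by positivity
  have h2 : (d.factorial : ℝ) ≠ 0 := by positivity
  have h3 : (g.factorial : ℝ) ≠ 0 := by positivity
  have h4 : (k.factorial : ℝ) ≠ 0 := by positivity
  have h5 : ((k + 2 * d).factorial : ℝ) ≠ 0 := by positivity
  have h6 : (2 * ((k : ℝ) + d + 1) + 1) ≠ 0 := by positivity
  have h7 : (2 * ((k : ℝ) + d + 1) + 3) ≠ 0 := by positivity
  have h8 : ((k : ℝ) + d + 1 + 1) ≠ 0 := by positivity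
  have h9 : ((k : ℝ) + d + 1 + 1 + 1) ≠ 0 := by positivity
  have h10 : (2 * ((k : ℝ) + d + 1) + 1 + 1 + 1) ≠ 0 := by positivity
  field_simp
  ring

lemma alpha_top (k : ℕ) :
    (((k + 2).factorial : ℝ) * (2 * (k + 2) - (k + 2)).factorial * 2 ^ (k + 2)) /
      ((2 * (k + 2)).factorial * ((k + 2) - (k + 2)).factorial * (k + 2).factorial) =
    1 / ((2 * (k : ℝ) + 1) * (2 * k + 3)) *
    (((k.factorial : ℝ) * (2 * k - k).factorial * 2 ^ k) /
      ((2 * k).factorial * (k - k).factorial * k.factorial)) := by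
  rw [show 2 * (k + 2) - (k + 2) = k + 1 + 1 by omega,
    show 2 * k - k = k by omega, show 2 * (k + 2) = 2 * k + 1 + 1 + 1 + 1 by omega]
  simp only [Nat.factorial_succ, Nat.sub_self, Nat.factorial_zero]
  push_cast
  have h3 : ((2 * k).factorial : ℝ) ≠ 0 := by positivity
  have h4 : (k.factorial : ℝ) ≠ 0 := by positivity
  field_simp
  ring

lemma alpha_zero (n : ℕ) : 
    ((n.factorial : ℝ) * (2 * n - 0).factorial * 2 ^ 0) /
      ((2 * n).factorial * (n - 0).factorial * Nat.factorial 0) = 1 := by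
  have h3 : ((2 * n).factorial : ℝ) ≠ 0 := by positivity
  have h4 : (n.factorial : ℝ) ≠ 0 := by positivity
  simp
  field_simp

lemma alpha_one (n : ℕ) : 
    (((n + 1).factorial : ℝ) * (2 * (n + 1) - 1).factorial * 2 ^ 1) /
      ((2 * (n + 1)).factorial * (n + 1 - 1).factorial * Nat.factorial 1) = 1 := by
  rw [show 2 * (n + 1) - 1 = 2 * n + 1 by omega, show 2 * (n + 1) = 2 * n + 1 + 1 by omega,
    Nat.factorial_succ (2 * n + 1), Nat.factorial_succ n]
  have h3 : ((2 * n + 1).factorial : ℝ) ≠ 0 := by positivity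
  have h4 : (n.factorial : ℝ) ≠ 0 := by positivity
  simp
  field_simp
  ring

/-- Coefficients of the Bessel polynomials. -/
noncomputable def al (n k : ℕ) : ℝ := ((n.factorial : ℝ) * (2 * n - k).factorial * 2 ^ k) /
      ((2 * n).factorial * (n - k).factorial * k.factorial)

lemma besselQ_al (n : ℕ) (u : ℝ) : besselQ n u = ∑ k ∈ range (n + 1), al n k * u ^ k := rfl

lemma besselQ_rec (n : ℕ) (u : ℝ) : besselQ (n + 2) u =
    besselQ (n + 1) u + 1 / ((2 * n + 1) * (2 * n + 3)) * u ^ 2 * besselQ n u := by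
  rw [besselQ_al, besselQ_al, besselQ_al]
  have z : ∀ n, al n 0 = 1 := alpha_zero
  have o : ∀ n, al (n + 1) 1 = 1 := alpha_one
  have t : al (n + 2) (n + 1 + 1) = 1 / ((2 * (n : ℝ) + 1) * (2 * n + 3)) * al n n := alpha_top n
  rw [show ∑ k ∈ range (n + 2 + 1), al (n + 2) k * u ^ k =
      ∑ k ∈ range n, al (n + 2) (k + 1 + 1) * u ^ (k + 1 + 1)
        + al (n + 2) (n + 1 + 1) * u ^ (n + 1 + 1)
        + al (n + 2) (0 + 1) * u ^ (0 + 1) + al (n + 2) 0 * u ^ 0 by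
      rw [Finset.sum_range_succ' _ (n + 2), Finset.sum_range_succ' _ (n + 1),
        Finset.sum_range_succ _ n],
    show ∑ k ∈ range (n + 1 + 1), al (n + 1) k * u ^ k =
      ∑ k ∈ range n, al (n + 1) (k + 1 + 1) * u ^ (k + 1 + 1)
        + al (n + 1) (0 + 1) * u ^ (0 + 1) + al (n + 1) 0 * u ^ 0 by
      rw [Finset.sum_range_succ' _ (n + 1), Finset.sum_range_succ' _ n],
    Finset.sum_range_succ _ n, t, mul_add (_ * u ^ 2), Finset.mul_sum]
  simp only [zero_add]
  rw [z, z, o, o]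
  have : ∀ k ∈ range n,
    al (n + 2) (k + 1 + 1) * u ^ (k + 1 + 1) = al (n + 1) (k + 1 + 1) * u ^ (k + 1 + 1)
    + 1 / ((2 * (n : ℝ) + 1) * (2 * n + 3)) * u ^ 2 * (al n k * u ^ k) := by
    intro k hk
    have hk := Finset.mem_range.mp hk
    obtain ⟨d, rfl⟩ : ∃ d, n = k + d + 1 := ⟨n - k - 1, by omega⟩
    have : al (k + d + 1 + 2) (k + 1 + 1) = al (k + d + 1 + 1) (k + 1 + 1)
      + 1 / ((2 * (k + d + 1 : ℝ) + 1) * (2 * (k + d + 1) + 3)) * al (k + d + 1) k := alpha_rec k d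
    rw [this]
    push_cast
    ring
  rw [Finset.sum_congr rfl this, Finset.sum_add_distrib]
  ring

lemma QP_eval (n : ℕ) (u : ℝ) : (QP n).eval u = besselQ n u := by
  induction n using Nat.twoStepInduction with
  | zero => simp [QP, besselQ]
  | one => simp [QP, besselQ, Finset.sum_range_succ, Nat.factorial]
  | more n h1 h2 =>
    rw [besselQ_rec, QP, ← h1, ← h2]
    simp

open Polynomial in
lemma QP_deriv (n : ℕ) : derivative (QP (n + 1)) =
    QP (n + 1) - C (1 / (2 * n + 1 : ℝ)) * X * QP n := by
  induction n using Nat.twoStepInduction with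
  | zero => simp [QP]
  | one =>
    simp [QP]
    have : (C (3 : ℝ)) * C (3⁻¹) = 1 := by rw [← C_mul]; norm_num
    have h3 : (C (3 : ℝ)) = 3 := rfl
    have h2 : (C (2 : ℝ)) = 2 := rfl
    have h' : (C ((2 + 1 : ℝ)⁻¹)) = C (3⁻¹) := by norm_num
    simp only [h']
    rw [h3] at this
    linear_combination X * this
  | more n h1 h2 =>
    rw [show n + 2 + 1 = (n + 1) + 2 from rfl, QP]
    simp only [derivative_add, derivative_mul, derivative_C, derivative_X_pow]
    rw [h1, h2, show QP (n + 1 + 1) =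
      QP (n + 1) + C (1 / ((2 * n + 1) * (2 * n + 3) : ℝ)) * X ^ 2 * QP n from rfl]
    have g1 : (2 * (n : ℝ) + 1) ≠ 0 := by positivity
    have g2 : (2 * (n : ℝ) + 3) ≠ 0 := by positivity
    have g3 : (2 * (n : ℝ) + 5) ≠ 0 := by positivity
    have f1 : (2 * ((n + 1 : ℕ) : ℝ) + 1) = 2 * n + 3 := by push_cast; ring
    have f2 : (2 * ((n + 1 : ℕ) : ℝ) + 3) = 2 * n + 5 := by push_cast; ring
    have f3 : (2 * ((n + 2 : ℕ) : ℝ) + 1) = 2 * n + 5 := by push_cast; ring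
    rw [f1, f2, f3]
    have k1 : - C (1 / (2 * (n : ℝ) + 3)) + C 2 * C (1 / ((2 * (n : ℝ) + 3) * (2 * n + 5)))
        = - C (1 / (2 * (n : ℝ) + 5)) := by
      rw [← C_mul, ← C_neg, ← C_neg, ← C_add]
      congr 1
      field_simp
      ring
    have k2 : C (1 / ((2 * (n : ℝ) + 3) * (2 * n + 5))) * C (1 / (2 * (n : ℝ) + 1))
        = C (1 / (2 * (n : ℝ) + 5)) * C (1 / ((2 * (n : ℝ) + 1) * (2 * n + 3))) := by
      rw [← C_mul, ← C_mul]
      congr 1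
      field_simp
    simp only [Nat.cast_ofNat] at *
    linear_combination X * QP (n + 1) * k1 - X ^ 3 * QP n * k2

open Polynomial in
lemma QP_deg (n : ℕ) : (QP n).degree = n := by
  suffices h : (QP n).natDegree ≤ n ∧ (QP n).coeff n ≠ 0 by
    apply degree_eq_of_le_of_coeff_ne_zero _ h.2
    exact natDegree_le_iff_degree_le.mp h.1
  induction n using Nat.twoStepInduction with
  | zero => simp [QP]
  | one => 
    simp [QP, coeff_one]
    compute_degree
  | more n h1 h2 =>
    rw [QP]
    constructor
    · compute_degree
      have := h1.1
      have := h2.1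
      simp; omega
    · rw [coeff_add, coeff_eq_zero_of_natDegree_lt (by omega), mul_assoc, coeff_C_mul,
        coeff_X_pow_mul]
      have : (2 * (n : ℝ) + 1) ≠ 0 := by positivity
      have : (2 * (n : ℝ) + 3) ≠ 0 := by positivity
      simp
      refine ⟨⟨by assumption, by assumption⟩, h1.2⟩
lemma poch_succ (x : ℝ) (j : ℕ) : poch x (j + 1) = poch x j * (x + j) := by
  unfold poch; rw [Finset.prod_range_succ]

lemma poch_half_ne (j : ℕ) : poch (1/2) j ≠ 0 := by
  unfold poch
  apply Finset.prod_ne_zero_iff.mpr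
  intro i _
  positivity

/-- The candidate coefficients. -/
noncomputable def Bc (n m : ℕ) (a : ℝ) (k : ℕ) : ℝ :=
  a ^ ((k : ℤ) - m) * (1 - a) ^ ((k : ℤ) - n) *
    (poch (1/2) (n + m - k) * poch (1/2) k) / (poch (1/2) n * poch (1/2) m) *
      Ph a (n + m + 1) (m - k - 1) (2 * (n + m - k))

lemma Bc_large (n m : ℕ) (a : ℝ) (k : ℕ) (h : n + m < k) : Bc n m a k = 0 := by
  rw [Bc, Ph_neg _ _ _ _ (by omega)]; simp

lemma Bc_symm (n m : ℕ) (a : ℝ) (k : ℕ) : Bc n m a k = Bc m n (1 - a) k := by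
  rw [Bc, Bc, Ph_reflect, Even.neg_one_zpow (by simp), add_comm m n, sub_sub_cancel]
  have e1 : 2 * ((n : ℤ) + m - k) - 1 - ((n + m + 1 : ℕ) : ℤ) - (m - k - 1) = n - k - 1 := by
    push_cast; ring
  have e2 : 2 * ((n : ℤ) + m - k) = 2 * (m + n - k) := by ring
  rw [e1, e2]
  ring

lemma Bc_zero (n m : ℕ) (a : ℝ) : Bc (n + 1) (m + 1) a 0 = 0 := by
  have := Ph_vanish a (n + 1 + (m + 1) + 1) m (2 * (((n + 1 : ℕ) : ℤ) + (m + 1 : ℕ) - (0 : ℕ)))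
    (by push_cast; omega)
  rw [Bc]
  have e : ((m + 1 : ℕ) : ℤ) - (0 : ℕ) - 1 = m := by push_cast; ring
  rw [e, this, mul_zero]

lemma Bc_rec (n m : ℕ) (a : ℝ) (ha : a ≠ 0) (hb : 1 - a ≠ 0) (k : ℕ) :
    Bc (n + 1) (m + 1) a (k + 1) * (1 / (2 * k + 1)) =
      a ^ 2 * (1 / (2 * n + 1)) * Bc n (m + 1) a k
      + (1 - a) ^ 2 * (1 / (2 * m + 1)) * Bc (n + 1) m a k := by
  unfold Bc
  have e1 : n + 1 + (m + 1) - (k + 1) = n + m + 1 - k := by omega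
  have e2 : n + (m + 1) - k = n + m + 1 - k := by omega
  have e3 : n + 1 + m - k = n + m + 1 - k := by omega
  have e4 : n + 1 + (m + 1) + 1 = n + m + 2 + 1 := by ring
  have e5 : n + (m + 1) + 1 = n + m + 2 := by ring
  have e6 : n + 1 + m + 1 = n + m + 2 := by ring
  rw [e1, e2, e3, e4, e5, e6]
  obtain ⟨s, hs⟩ : ∃ s : ℤ, s = 2 * (n + m + 1 - k) := ⟨_, rfl⟩
  obtain ⟨q, hq⟩ : ∃ q : ℤ, q = m - k - 1 := ⟨_, rfl⟩
  rw [show 2 * (((n + 1 : ℕ) : ℤ) + (m + 1 : ℕ) - (k + 1 : ℕ)) = s by push_cast; omega,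
    show 2 * ((n : ℤ) + (m + 1 : ℕ) - k) = s by push_cast; omega,
    show 2 * (((n + 1 : ℕ) : ℤ) + m - k) = s by push_cast; omega,
    show ((m + 1 : ℕ) : ℤ) - (k + 1 : ℕ) - 1 = q by push_cast; omega,
    show ((m + 1 : ℕ) : ℤ) - k - 1 = q + 1 by push_cast; omega, ← hq, Ph_pascal, Ph]
  rw [show ((k + 1 : ℕ) : ℤ) - (m + 1 : ℕ) = k - m by push_cast; ring,
    show ((k + 1 : ℕ) : ℤ) - (n + 1 : ℕ) = k - n by push_cast; ring,
    show (k : ℤ) - (m + 1 : ℕ) = k - m - 1 by push_cast; ring,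
    show (k : ℤ) - (n + 1 : ℕ) = k - n - 1 by push_cast; ring,
    zpow_sub_one₀ ha, zpow_sub_one₀ hb, poch_succ, poch_succ, poch_succ]
  have h1 := poch_half_ne n
  have h2 := poch_half_ne m
  have g1 : (2 * (n : ℝ) + 1) ≠ 0 := by positivity
  have g2 : (2 * (m : ℝ) + 1) ≠ 0 := by positivity
  have g3 : (2 * (k : ℝ) + 1) ≠ 0 := by positivity
  have f1 : (1 / 2 + (n : ℝ)) = (2 * n + 1) / 2 := by ring
  have f2 : (1 / 2 + (m : ℝ)) = (2 * m + 1) / 2 := by ring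
  have f3 : (1 / 2 + (k : ℝ)) = (2 * k + 1) / 2 := by ring
  rw [f1, f2, f3]
  generalize poch (1/2) n = pn at *
  generalize poch (1/2) m = pm at *
  generalize a ^ ((k : ℤ) - m) = x
  generalize (1 - a) ^ ((k : ℤ) - n) = y
  field_simp
  ring

lemma Bc_top (n : ℕ) (a : ℝ) : Bc n 0 a n = a ^ n := by
  have h1 := poch_half_ne n
  rw [Bc]
  simp [Ph_zero]
  simp [poch] at *
  field_simp

/-- Generic step of the three-term recurrence. -/
lemma Bc_three_aux (n k : ℕ) (a : ℝ) (ha : a ≠ 0) (hb : 1 - a ≠ 0) (hk : k ≤ n + 1) :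
    Bc (n + 2) 0 a k = Bc (n + 1) 0 a k + a ^ 2 * (1 / ((2 * n + 1) * (2 * n + 3))) *
     (a ^ ((k : ℤ) - 2) * (1 - a) ^ ((k : ℤ) - 2 - n) * (poch (1/2) (n + 2 - k) *
         (4 * poch (1/2) k)) / poch (1/2) n
          * Ph a (n + 1) (-k + 1) (2 * (n + 2 - k))
       - a ^ ((k : ℤ) - 1) * (1 - a) ^ ((k : ℤ) - 1 - n) * (poch (1/2) (n + 1 - k) *
         (4 * poch (1/2) k * (k + 1 / 2))) / poch (1/2) n
          * Ph a (n + 1) (-k) (2 * (n + 1 - k))) := by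
  have h := Ph_three a n k (n + 1 - k) (by ring)
  unfold Bc
  have e1 : n + 2 + 0 - k = n + 1 - k + 1 := by omega
  have e2 : n + 1 + 0 - k = n + 1 - k := by omega
  rw [e1, e2, show n + 2 + 0 + 1 = n + 3 by ring, show n + 1 + 0 + 1 = n + 2 by ring]
  obtain ⟨N, hN⟩ : ∃ N : ℤ, N = n + 1 - k := ⟨_, rfl⟩
  rw [← hN] at h
  rw [show 2 * (((n + 2 : ℕ) : ℤ) + (0 : ℕ) - k) = 2 * N + 2 by push_cast; omega,
    show 2 * (((n + 1 : ℕ) : ℤ) + (0 : ℕ) - k) = 2 * N by push_cast; omega,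
    show 2 * ((n : ℤ) + 2 - k) = 2 * N + 2 by omega,
    show 2 * ((n : ℤ) + 1 - k) = 2 * N by omega,
    show ((0 : ℕ) : ℤ) - k - 1 = -k - 1 by push_cast; omega,
    show (k : ℤ) - (n + 2 : ℕ) = k - n - 1 - 1 by push_cast; ring,
    show (k : ℤ) - (n + 1 : ℕ) = k - n - 1 by push_cast; ring,
    show (k : ℤ) - 2 - n = k - n - 1 - 1 by ring,
    show (k : ℤ) - 1 - n = k - n - 1 by ring,
    show (k : ℤ) - (0 : ℕ) = k by simp,
    show (k : ℤ) - 2 = k - 1 - 1 by ring, zpow_sub_one₀ ha, zpow_sub_one₀ ha,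
    zpow_sub_one₀ hb, zpow_sub_one₀ hb, poch_succ _ (n + 1), poch_succ, poch_succ]
  have hNr : ((n + 1 - k : ℕ) : ℝ) = N := by
    rw [hN, Nat.cast_sub hk]; push_cast; ring
  rw [hNr]
  have h1 := poch_half_ne n
  have h0 : poch (1/2) 0 = 1 := by simp [poch]
  rw [h0]
  have g1 : (2 * (n : ℝ) + 1) ≠ 0 := by positivity
  have g3 : (2 * (n : ℝ) + 3) ≠ 0 := by positivity
  have f1 : (1 / 2 + (n : ℝ)) = (2 * n + 1) / 2 := by ring
  have f2 : (1 / 2 + ((n + 1 : ℕ) : ℝ)) = (2 * n + 3) / 2 := by push_cast; ring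
  have f3 : (1 / 2 + (N : ℝ)) = (2 * N + 1) / 2 := by ring
  rw [f1, f2, f3]
  push_cast at h
  generalize poch (1/2) n = pn at *
  generalize poch (1/2) k = pk at *
  generalize poch (1/2) (n + 1 - k) = pN at *
  generalize a ^ (k : ℤ) = x
  generalize (1 - a) ^ ((k : ℤ) - n) = y
  generalize Ph a (n + 3) (-k - 1) (2 * N + 2) = P1 at *
  generalize Ph a (n + 1) (-k + 1) (2 * N + 2) = P2 at *
  generalize Ph a (n + 2) (-k - 1) (2 * N) = P3 at *
  generalize Ph a (n + 1) (-k) (2 * N) = P4 at *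
  field_simp
  linear_combination (4 * x * y * pN * pk) * h

lemma Bc_three_zero (n : ℕ) (a : ℝ) (ha : a ≠ 0) (hb : 1 - a ≠ 0) :
    Bc (n + 2) 0 a 0 = Bc (n + 1) 0 a 0 := by
  rw [Bc_three_aux n 0 a ha hb (by omega)]
  have h1 := Ph_vanish a (n + 1) 1 (2 * (n + 2)) (by push_cast; omega)
  have h2 := Ph_vanish a (n + 1) 0 (2 * (n + 1)) (by push_cast; omega)
  simp at h1 h2
  simp [h1, h2]

lemma Bc_three_one (n : ℕ) (a : ℝ) (ha : a ≠ 0) (hb : 1 - a ≠ 0) :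
    Bc (n + 2) 0 a 1 = Bc (n + 1) 0 a 1
      - a ^ 2 * (1 / ((2 * n + 1) * (2 * n + 3))) * (3 * Bc n 0 a 0) := by
  rw [Bc_three_aux n 1 a ha hb (by omega)]
  have h2 := Ph_vanish a (n + 1) 0 (2 * (n + 1)) (by push_cast; omega)
  rw [show -((1 : ℕ) : ℤ) + 1 = (0 : ℕ) by simp,
    show 2 * ((n : ℤ) + 2 - (1 : ℕ)) = 2 * (n + 1) by push_cast; ring, h2, Bc.eq_1 n 0 a 0,
    show ((0 : ℕ) : ℤ) - (0 : ℕ) - 1 = -(1 : ℕ) by simp,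
    show 2 * ((n : ℤ) + (0 : ℕ) - (0 : ℕ)) = 2 * (n + 1 - (1 : ℕ)) by push_cast; ring]
  simp [poch]
  ring

lemma Bc_three_gen (n k : ℕ) (a : ℝ) (ha : a ≠ 0) (hb : 1 - a ≠ 0) (hk : k ≤ n) :
    Bc (n + 2) 0 a (k + 2) = Bc (n + 1) 0 a (k + 2)
      + a ^ 2 * (1 / ((2 * n + 1) * (2 * n + 3))) *
        ((2 * k + 1) * (2 * k + 3) * Bc n 0 a k - (2 * k + 3) * (2 * k + 5) * Bc n 0 a (k + 1)) := by
  rcases hk.lt_or_eq with h | rfl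
  · rw [Bc_three_aux n (k + 2) a ha hb (by omega), Bc, Bc, Bc]
    rw [show n + 2 - (k + 2) = n - k by omega, show n + 1 - (k + 2) = n - (k + 1) by omega,
      poch_succ _ (k + 1), poch_succ _ k]
    rw [show -((k + 2 : ℕ) : ℤ) + 1 = (0 : ℕ) - k - 1 by push_cast; ring,
     show -((k + 2 : ℕ) : ℤ) = (0 : ℕ) - (k + 1 : ℕ) - 1 by push_cast; ring,
     show 2 * ((n : ℤ) + 2 - (k + 2 : ℕ)) = 2 * (n + (0 : ℕ) - k) by push_cast; ring,
     show 2 * ((n : ℤ) + 1 - (k + 2 : ℕ)) = 2 * (n + (0 : ℕ) - (k + 1 : ℕ)) by push_cast; ring,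
     show ((k + 2 : ℕ) : ℤ) - 2 = k - (0 : ℕ) by push_cast; ring,
     show ((k + 2 : ℕ) : ℤ) - 1 = (k + 1 : ℕ) - (0 : ℕ) by push_cast; ring]
    have h0 : poch (1/2) 0 = 1 := by simp [poch]
    simp only [h0, add_zero, Nat.cast_zero, sub_zero]
    push_cast
    ring
  · rw [Bc_top, Bc_top, Bc_large _ _ _ _ (by omega), Bc_large _ _ _ _ (by omega)]
    have g1 : (2 * (k : ℝ) + 1) ≠ 0 := by positivity
    have g3 : (2 * (k : ℝ) + 3) ≠ 0 := by positivity
    field_simp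
    ring
open Polynomial

lemma QP_X2 (k : ℕ) : X ^ 2 * QP k =
    C ((2 * k + 1) * (2 * k + 3) : ℝ) * (QP (k + 2) - QP (k + 1)) := by
  have g1 : (2 * (k : ℝ) + 1) ≠ 0 := by positivity
  have g3 : (2 * (k : ℝ) + 3) ≠ 0 := by positivity
  have h : C ((2 * k + 1) * (2 * k + 3) : ℝ) * C (1 / ((2 * k + 1) * (2 * k + 3) : ℝ)) = 1 := by
    rw [← C_mul, mul_one_div_cancel (by positivity), C_1]
  rw [QP]
  linear_combination (-(X ^ 2 * QP k)) * h

lemma sum_three (n : ℕ) (c : ℝ) (x y z : ℕ → ℝ) (h0 : x 0 = y 0) (h1 : x 1 = y 1 - c * (3 * z 0))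
    (h2 : ∀ k ≤ n, x (k + 2) = y (k + 2) + c * ((2 * k + 1) * (2 * k + 3) * z k
      - (2 * k + 3) * (2 * k + 5) * z (k + 1))) (hy : y (n + 2) = 0) (hz : z (n + 1) = 0) :
    ∑ k ∈ range (n + 3), C (x k) * QP k = ∑ k ∈ range (n + 2), C (y k) * QP k
      + C c * X ^ 2 * ∑ k ∈ range (n + 1), C (z k) * QP k := by
  have e1 : ∑ k ∈ range (n + 2), C (y k) * QP k = ∑ k ∈ range (n + 3), C (y k) * QP k := by
    rw [Finset.sum_range_succ _ (n + 2), hy]; simp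
  have e2 : X ^ 2 * ∑ k ∈ range (n + 1), C (z k) * QP k =
      ∑ k ∈ range (n + 1), C ((2 * k + 1) * (2 * k + 3) * z k) * QP (k + 2)
      - ∑ k ∈ range (n + 2), C ((2 * k + 1) * (2 * k + 3) * z k) * QP (k + 1) := by
    rw [Finset.sum_range_succ _ (n + 1), hz]
    simp only [mul_zero, C_0, zero_mul, add_zero]
    rw [← Finset.sum_sub_distrib, Finset.mul_sum]
    apply Finset.sum_congr rfl
    intro k _
    rw [mul_left_comm, QP_X2, C_mul (b := z k)]
    ring
  rw [e1, mul_assoc, e2, Finset.sum_range_succ' _ (n + 2), Finset.sum_range_succ' _ (n + 1),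
    Finset.sum_range_succ' _ (n + 2), Finset.sum_range_succ' _ (n + 1),
    Finset.sum_range_succ' _ (n + 1), h0]
  simp only [zero_add]
  rw [h1]
  have e3 : ∑ k ∈ range (n + 1), C (x (k + 1 + 1)) * QP (k + 1 + 1) =
      ∑ k ∈ range (n + 1), C (y (k + 1 + 1)) * QP (k + 1 + 1) +
      C c * (∑ k ∈ range (n + 1), C ((2 * k + 1) * (2 * k + 3) * z k) * QP (k + 2)
      - ∑ k ∈ range (n + 1), C ((2 * (k + 1 : ℕ) + 1) * (2 * (k + 1 : ℕ) + 3) * z (k + 1))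
          * QP (k + 1 + 1)) := by
    rw [← Finset.sum_sub_distrib, Finset.mul_sum, ← Finset.sum_add_distrib]
    apply Finset.sum_congr rfl
    intro k hk
    have := Finset.mem_range.mp hk
    rw [show k + 1 + 1 = k + 2 from rfl, h2 k (by omega), ← sub_mul, ← mul_assoc, ← add_mul,
      ← C_sub, ← C_mul, ← C_add]
    congr 2
    push_cast
    ring
  rw [e3]
  have e4 : C (y 1 - c * (3 * z 0)) = C (y 1) -
      C c * C ((2 * (0 : ℕ) + 1) * (2 * (0 : ℕ) + 3) * z 0) := by
    rw [← C_mul, ← C_sub]; congr 1; push_cast; ring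
  rw [e4]
  ring

lemma QP_base (n : ℕ) (a : ℝ) (ha : a ≠ 0) (hb : 1 - a ≠ 0) :
    (QP n).comp (C a * X) = ∑ k ∈ range (n + 1), C (Bc n 0 a k) * QP k := by
  induction n using Nat.twoStepInduction with
  | zero => simp [QP, Bc_top]
  | one =>
    have h1 : Bc 1 0 a 0 = 1 - a := by
      rw [Bc]
      simp [Ph, GB, gbinom, poch, Finset.prod_range_succ]
      field_simp
      ring
    rw [Finset.sum_range_succ, Finset.sum_range_succ, Bc_top, h1]
    simp [QP]
    ring
  | more n i1 i2 =>
    rw [show n + 2 + 1 = n + 3 from rfl,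
      sum_three n (a ^ 2 * (1 / ((2 * n + 1) * (2 * n + 3)))) _ (Bc (n + 1) 0 a) (Bc n 0 a)
      (Bc_three_zero n a ha hb) (Bc_three_one n a ha hb)
      (fun k hk => Bc_three_gen n k a ha hb hk) (Bc_large _ _ _ _ (by omega))
      (Bc_large _ _ _ _ (by omega)), ← i1, ← i2, QP]
    simp only [add_comp, mul_comp, C_comp, X_comp, pow_comp, C_mul, C_pow]
    ring

lemma eq_zero_of_deriv (P : ℝ[X]) (h : derivative P = P) : P = 0 := by
  by_contra h0
  have := degree_derivative_lt h0
  rw [h] at this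
  exact lt_irrefl _ this

lemma QP_comp_deriv (n : ℕ) (a : ℝ) : derivative ((QP (n + 1)).comp (C a * X)) =
    C a * (QP (n + 1)).comp (C a * X)
      - C (a ^ 2 * (1 / (2 * n + 1))) * X * (QP n).comp (C a * X) := by
  rw [derivative_comp, QP_deriv]
  simp only [sub_comp, mul_comp, C_comp, X_comp, derivative_mul, derivative_C, derivative_X,
    C_mul, C_pow]
  ring

lemma QP_main (a : ℝ) (ha : a ≠ 0) (hb : 1 - a ≠ 0) (s n m : ℕ) (hs : n + m = s) :
    (QP n).comp (C a * X) * (QP m).comp (C (1 - a) * X) =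
      ∑ k ∈ range (n + m + 1), C (Bc n m a k) * QP k := by
  induction s generalizing n m with
  | zero =>
    obtain rfl : n = 0 := by omega
    obtain rfl : m = 0 := by omega
    rw [QP_base 0 a ha hb]; simp [QP]
  | succ s ih =>
    rcases m with _ | m
    · rw [QP_base n a ha hb]; simp [QP]
    rcases n with _ | n
    · rw [QP_base (m + 1) (1 - a) hb (by simpa using ha)]
      simp only [QP, one_comp, one_mul, zero_add]
      apply Finset.sum_congr rfl
      intro k _
      rw [Bc_symm 0]
    have i1 := ih n (m + 1) (by omega)
    have i2 := ih (n + 1) m (by omega)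
    rw [← sub_eq_zero]
    apply eq_zero_of_deriv
    rw [derivative_sub, derivative_mul, QP_comp_deriv, QP_comp_deriv,
      Finset.sum_range_succ', Bc_zero]
    simp only [C_0, zero_mul, add_zero]
    have hd : derivative (∑ k ∈ range (n + 1 + (m + 1)),
          C (Bc (n + 1) (m + 1) a (k + 1)) * QP (k + 1)) =
        ∑ k ∈ range (n + 1 + (m + 1)), C (Bc (n + 1) (m + 1) a (k + 1)) * QP (k + 1)
        - X * (C (a ^ 2 * (1 / (2 * n + 1))) * ∑ k ∈ range (n + (m + 1) + 1),
            C (Bc n (m + 1) a k) * QP k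
          + C ((1 - a) ^ 2 * (1 / (2 * m + 1))) * ∑ k ∈ range (n + 1 + m + 1),
            C (Bc (n + 1) m a k) * QP k) := by
      rw [show n + (m + 1) + 1 = n + 1 + (m + 1) by ring, show n + 1 + m + 1 = n + 1 + (m + 1) by ring,
        Finset.mul_sum, Finset.mul_sum, ← Finset.sum_add_distrib, Finset.mul_sum,
        ← Finset.sum_sub_distrib, derivative_sum]
      apply Finset.sum_congr rfl
      intro k _
      have h := Bc_rec n m a ha hb k
      have hC := congrArg (C : ℝ → ℝ[X]) h
      simp only [C_mul, C_add] at hC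
      rw [derivative_C_mul, QP_deriv]
      simp only [C_mul]
      linear_combination (-(X * QP k)) * hC
    rw [hd, ← i1, ← i2]
    have hab : C a + C (1 - a) = 1 := by rw [← C_add]; simp
    linear_combination ((QP (n + 1)).comp (C a * X) * (QP (m + 1)).comp (C (1 - a) * X)) * hab

lemma QP_unique (N : ℕ) (x y : ℕ → ℝ)
    (h : ∑ k ∈ range N, C (x k) * QP k = ∑ k ∈ range N, C (y k) * QP k) (k : ℕ) (hk : k < N) :
    x k = y k := by
  let S : Polynomial.Sequence ℝ := ⟨QP, QP_deg⟩
  have hl := S.linearIndependent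
  have := linearIndependent_iff'.mp hl (range N) (fun k => x k - y k) (by
    rw [← sub_eq_zero, ← Finset.sum_sub_distrib] at h
    rw [← h]
    apply Finset.sum_congr rfl
    intro i _
    rw [smul_eq_C_mul, C_sub, sub_mul]) k (Finset.mem_range.mpr hk)
  exact sub_eq_zero.mp this

theorem bessel_linearization_single_sum
    (n m : ℕ) (a : ℝ) (ha : a ≠ 0) (ha1 : a ≠ 1)
    (β : ℕ → ℝ)
    (hβ : ∀ u : ℝ, besselQ n (a * u) * besselQ m ((1 - a) * u) =
      ∑ k ∈ Finset.range (n + m + 1), β k * besselQ k u)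
    (k : ℕ) (hk : k ≤ n + m) :
    β k = a ^ (2 * n + m - k) * (1 - a) ^ ((k : ℤ) - n) *
      (poch (1/2) (n + m - k) * poch (1/2) k) / (poch (1/2) n * poch (1/2) m) *
      ∑ j ∈ Finset.range (2 * (n + m - k) + 1),
        (-1 : ℝ) ^ j * ((n + m + 1).choose (2 * (n + m - k) - j)) *
          gbinom ((k : ℤ) - m + j) j * a ^ (-(j : ℤ)) := by
  have hb : 1 - a ≠ 0 := sub_ne_zero.mpr (Ne.symm ha1)
  have hP : ∑ k ∈ range (n + m + 1), C (β k) * QP k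
      = ∑ k ∈ range (n + m + 1), C (Bc n m a k) * QP k := by
    rw [← QP_main a ha hb (n + m) n m rfl]
    apply Polynomial.funext
    intro u
    have := hβ u
    simp only [eval_finsetSum, eval_mul, eval_C, eval_comp, eval_X, QP_eval]
    rw [this]
  rw [QP_unique _ _ _ hP k (by omega), Bc]
  have e : 2 * ((n : ℤ) + m - k) = ((2 * (n + m - k) : ℕ) : ℤ) := by
    push_cast [Nat.cast_sub hk]; ring
  rw [e, Ph_sum_nat]
  have hz : a ^ (2 * n + m - k) = a ^ ((k : ℤ) - m) * a ^ (2 * (n + m - k)) := by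
    rw [← zpow_natCast, ← zpow_natCast, ← zpow_add₀ ha]
    congr 1
    push_cast [Nat.cast_sub hk, Nat.cast_sub (show k ≤ 2 * n + m by omega)]
    ring
  have hsum : ∑ j ∈ range (2 * (n + m - k) + 1), ((n + m + 1).choose (2 * (n + m - k) - j) : ℝ)
        * a ^ (2 * (n + m - k) - j) * gbinom ((m : ℤ) - k - 1) j
      = a ^ (2 * (n + m - k)) * ∑ j ∈ Finset.range (2 * (n + m - k) + 1),
        (-1 : ℝ) ^ j * ((n + m + 1).choose (2 * (n + m - k) - j)) *
          gbinom ((k : ℤ) - m + j) j * a ^ (-(j : ℤ)) := by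
    rw [Finset.mul_sum]
    apply Finset.sum_congr rfl
    intro j hj
    have hj := Finset.mem_range.mp hj
    rw [gbinom_neg, show (j : ℤ) - 1 - (m - k - 1) = k - m + j by ring,
      pow_sub₀ a ha (by omega : j ≤ 2 * (n + m - k)), zpow_neg, zpow_natCast]
    ring
  rw [hsum, hz]
  ring
end

section
/- Let n, m be natural numbers and let a be a real number with a ≠ 0 and a ≠ 1. Then for every k with ⌈(n+m−1)/2⌉ ≤ k ≤ n+m, β_k^{(n,m)}(a) = a^{2n+m−k} (1−a)^{k−n} · ((1/2)_{n+m−k} (1/2)_k)/((1/2)_n (1/2)_m) · C(n+m+1, 2(n+m−k)) · Σ_{j=0}^{2(n+m−k)} ((−2(n+m)+2k)_j (k−m+1)_j)/((2k−m−n+2)_j · j!) · a^{−j} (the terminating Gauss hypergeometric series ₂F₁(−2n−2m+2k, −m+k+1; 2k−m−n+2; 1/a); note 2k−m−n+2 ≥ 1 under the stated hypothesis, so no denominator Pochhammer vanishes). -/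
open Finset

open Polynomial in
/-- coefficients of the Bessel polynomial -/
noncomputable def cc (n l : ℕ) : ℝ :=
  ((n.factorial : ℝ) * (2 * n - l).factorial * 2 ^ l) /
      ((2 * n).factorial * (n - l).factorial * l.factorial)

open Polynomial in
/-- Bessel polynomial as a polynomial -/
noncomputable def Qp (n : ℕ) : ℝ[X] := ∑ l ∈ Finset.range (n + 1), C (cc n l) * X ^ l

lemma coeff_Qp (n l : ℕ) : (Qp n).coeff l = if l ≤ n then cc n l else 0 := by
  simp [Qp, Polynomial.coeff_C_mul, Polynomial.coeff_X_pow]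

lemma eval_Qp (n : ℕ) (u : ℝ) : (Qp n).eval u = besselQ n u := by
  simp [Qp, besselQ, Polynomial.eval_finsetSum, cc]

lemma cc_zero (n : ℕ) : cc n 0 = 1 := by
  have h1 := Nat.factorial_ne_zero n
  have h2 := Nat.factorial_ne_zero (2 * n)
  simp [cc]; field_simp

lemma cc_one (n : ℕ) : cc (n + 1) 1 = 1 := by
  have h1 := Nat.factorial_ne_zero n
  have h2 := Nat.factorial_ne_zero (2 * n)
  simp only [cc, show 2 * (n + 1) = 2 * n + 1 + 1 by ring, show 2 * n + 1 + 1 - 1 = 2 * n + 1 by omega,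
    show n + 1 - 1 = n by omega, Nat.factorial_succ, Nat.factorial_zero]
  push_cast; field_simp; ring

/-- explicit form -/
lemma cc_add (l d : ℕ) : cc (l + d) l = (((l + d).factorial : ℝ) * (l + 2 * d).factorial * 2 ^ l) /
      ((2 * l + 2 * d).factorial * d.factorial * l.factorial) := by
  rw [cc, show 2 * (l + d) - l = l + 2 * d by omega, show l + d - l = d by omega, mul_add]

lemma cc_d1 (l d : ℕ) : ((l : ℝ) + 2) * cc (l + 1 + d + 1) (l + 2) =
    cc (l + 1 + d + 1) (l + 1) - 1 / (2 * (l + 1 + d) + 1) * cc (l + 1 + d) l := by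
  rw [show l + 1 + d + 1 = l + 2 + d by ring, cc_add, show l + 2 + d = l + 1 + (d + 1) by ring, cc_add,
    show l + 1 + d = l + (d + 1) by ring, cc_add]
  simp only [show l + 2 + 2 * d = l + 2 * d + 1 + 1 by ring, show 2 * (l + 2) + 2 * d = 2 * l + 2 * d + 1 + 1 + 1 + 1 by ring,
    show l + 1 + (d + 1) = l + d + 1 + 1 by ring, show l + 1 + 2 * (d + 1) = l + 2 * d + 1 + 1 + 1 by ring,
    show 2 * (l + 1) + 2 * (d + 1) = 2 * l + 2 * d + 1 + 1 + 1 + 1 by ring, show l + (d + 1) = l + d + 1 by ring,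
    show l + 2 * (d + 1) = l + 2 * d + 1 + 1 by ring, show 2 * l + 2 * (d + 1) = 2 * l + 2 * d + 1 + 1 by ring,
    show l + 2 = l + 1 + 1 by ring, Nat.factorial_succ]
  have h1 := Nat.factorial_ne_zero l
  have h2 := Nat.factorial_ne_zero d
  have h3 := Nat.factorial_ne_zero (l + d)
  have h4 := Nat.factorial_ne_zero (2 * l + 2 * d)
  have h5 := Nat.factorial_ne_zero (l + 2 * d)
  push_cast
  field_simp
  ring

lemma cc_d2 (l : ℕ) : cc (l + 1) (l + 1) = 1 / (2 * l + 1) * cc l l := by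
  have e1 := cc_add (l+1) 0
  have e2 := cc_add l 0
  simp only [add_zero, mul_zero] at e1 e2
  rw [e1, e2, show 2 * (l + 1) = 2 * l + 1 + 1 by ring]
  simp only [Nat.factorial_succ]
  have h1 := Nat.factorial_ne_zero l
  have h4 := Nat.factorial_ne_zero (2 * l)
  push_cast
  field_simp
  ring

lemma cc_r1 (l d : ℕ) : cc (l + 1 + d) l = (2 * (l + 1 + d : ℝ) + 3) * (2 * (l + 1 + d : ℝ) + 1) *
    (cc (l + 1 + d + 2) (l + 2) - cc (l + 1 + d + 1) (l + 2)) := by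
  rw [show l + 1 + d + 1 = l + 2 + d by ring, cc_add, show l + 1 + d + 2 = l + 2 + (d + 1) by ring, cc_add,
    show l + 1 + d = l + (d + 1) by ring, cc_add]
  simp only [show l + 2 + 2 * d = l + 2 * d + 1 + 1 by ring, show 2 * (l + 2) + 2 * d = 2 * l + 2 * d + 1 + 1 + 1 + 1 by ring,
    show l + 2 + (d + 1) = l + d + 1 + 1 + 1 by ring, show l + 2 + 2 * (d + 1) = l + 2 * d + 1 + 1 + 1 + 1 by ring,
    show 2 * (l + 2) + 2 * (d + 1) = 2 * l + 2 * d + 1 + 1 + 1 + 1 + 1 + 1 by ring, show l + (d + 1) = l + d + 1 by ring,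
    show l + 2 * (d + 1) = l + 2 * d + 1 + 1 by ring, show 2 * l + 2 * (d + 1) = 2 * l + 2 * d + 1 + 1 by ring,
    show l + 2 + d = l + d + 1 + 1 by ring,
    show l + 2 = l + 1 + 1 by ring, Nat.factorial_succ]
  have h1 := Nat.factorial_ne_zero l
  have h2 := Nat.factorial_ne_zero d
  have h3 := Nat.factorial_ne_zero (l + d)
  have h4 := Nat.factorial_ne_zero (2 * l + 2 * d)
  have h5 := Nat.factorial_ne_zero (l + 2 * d)
  push_cast
  field_simp
  ring

lemma cc_r2 (l : ℕ) : cc l l = (2 * (l : ℝ) + 3) * (2 * l + 1) * cc (l + 2) (l + 2) := by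
  rw [cc_d2 (l+1), cc_d2 l]
  push_cast
  have : (2 * (l:ℝ) + 1) ≠ 0 := by positivity
  have : (2 * ((l:ℝ) + 1) + 1) ≠ 0 := by positivity
  field_simp
  ring

open Polynomial in
lemma Qp_deriv (n : ℕ) : derivative (Qp (n + 1)) =
    Qp (n + 1) - C (1 / (2 * (n : ℝ) + 1)) * (X * Qp n) := by
  ext l
  rw [coeff_derivative, coeff_sub, coeff_C_mul]
  rcases l with _ | l
  · simp [coeff_Qp, cc_zero, cc_one]
  · rw [coeff_X_mul]
    simp only [coeff_Qp]
    rcases lt_trichotomy l n with h | h | h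
    · obtain ⟨d, rfl⟩ := Nat.exists_eq_add_of_lt h
      rw [if_pos (by omega), if_pos (by omega), if_pos (by omega)]
      have := cc_d1 l d
      rw [show l + d + 1 = l + 1 + d by ring]
      push_cast
      linear_combination this
    · subst h
      rw [if_neg (by omega), if_pos (by omega), if_pos (by omega), cc_d2]
      ring
    · rw [if_neg (by omega), if_neg (by omega), if_neg (by omega)]
      ring

open Polynomial in
lemma Qp_rec (k : ℕ) : X ^ 2 * Qp k =
    C ((2 * (k : ℝ) + 3) * (2 * k + 1)) * (Qp (k + 2) - Qp (k + 1)) := by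
  ext l
  rw [coeff_C_mul, coeff_sub, coeff_X_pow_mul']
  rcases l with _ | _ | l
  · simp [coeff_Qp, cc_zero]
  · simp [coeff_Qp, cc_one]
  · rw [if_pos (by omega), show l + 1 + 1 - 2 = l by omega]
    simp only [coeff_Qp]
    rcases lt_trichotomy l k with h | h | h
    · obtain ⟨d, rfl⟩ := Nat.exists_eq_add_of_lt h
      rw [if_pos (by omega), if_pos (by omega), if_pos (by omega)]
      have := cc_r1 l d
      rw [show l + d + 1 = l + 1 + d by ring]
      push_cast
      linear_combination this
    · subst h
      rw [if_pos le_rfl, if_pos (by omega), if_neg (by omega)]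
      rw [cc_r2]; ring
    · rw [if_neg (by omega), if_neg (by omega), if_neg (by omega)]
      ring

open Polynomial in
lemma Qp_indep (N : ℕ) (γ : ℕ → ℝ) (h : ∑ k ∈ Finset.range N, C (γ k) * Qp k = 0) :
    ∀ k < N, γ k = 0 := by
  induction N with
  | zero => intro k hk; omega
  | succ N ih =>
    have hN : γ N = 0 := by
      have := congrArg (fun p => coeff p N) h
      simp only [finsetSum_coeff, coeff_C_mul, coeff_Qp, coeff_zero] at this
      rw [Finset.sum_range_succ, Finset.sum_eq_zero, zero_add, if_pos le_rfl] at this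
      · have h2 : cc N N ≠ 0 := by
          unfold cc; positivity
        exact (mul_eq_zero.mp this).resolve_right h2
      · intro x hx
        rw [Finset.mem_range] at hx
        rw [if_neg (by omega), mul_zero]
    rw [Finset.sum_range_succ, hN, C_0, zero_mul, add_zero] at h
    intro k hk
    rcases Nat.lt_succ_iff_lt_or_eq.mp hk with h1 | h1
    · exact ih h k h1
    · rw [h1, hN]

open Polynomial in
lemma eq_zero_of_derivative_eq (p : ℝ[X]) (h : derivative p = p) : p = 0 := by
  have h1 : p.natDegree = 0 := by
    by_contra h0
    have := natDegree_derivative_lt h0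
    rw [h] at this
    omega
  rw [← h, derivative_of_natDegree_zero h1]

open PowerSeries in
/-- `(1 + X / a) ^ z` -/
noncomputable def Fs (a : ℝ) (z : ℤ) : ℝ⟦X⟧ := rescale a⁻¹ (binomialSeries ℝ z)

open PowerSeries in
lemma Fs_succ (a : ℝ) (z : ℤ) : Fs a (z + 1) = (1 + C a⁻¹ * X) * Fs a z := by
  have h : binomialSeries ℝ (1 : ℤ) = 1 + X := by
    have := binomialSeries_nat (R := ℤ) (A := ℝ) 1
    simpa using this
  rw [Fs, binomialSeries_add, map_mul, h, map_add, map_one, rescale_X, mul_comm]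
  rfl

open PowerSeries in
lemma Fs_nat (a : ℝ) (d : ℕ) : Fs a d = (1 + C a⁻¹ * X) ^ d := by
  rw [Fs, binomialSeries_nat, map_pow, map_add, map_one, rescale_X]

open PowerSeries in
noncomputable def Sc (a : ℝ) (n m s : ℕ) : ℝ :=
  coeff (2 * s) ((1 + X) ^ (n + m + 1) * Fs a ((s : ℤ) - n - 1))

noncomputable def Gg (a : ℝ) (n m s : ℕ) : ℝ :=
  a ^ (n + s) * (1 - a) ^ ((m : ℤ) - s) * Sc a n m s

open PowerSeries in
lemma Sc_rec (a : ℝ) (ha : a ≠ 0) (n m s : ℕ) :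
    Sc a (n + 1) (m + 1) s = a * Sc a n (m + 1) s + (1 - a) * Sc a (n + 1) m s := by
  unfold Sc
  rw [← coeff_C_mul, ← coeff_C_mul, ← map_add]
  congr 1
  have e1 : ((s : ℤ) - n - 1) = ((s : ℤ) - (n + 1 : ℕ) - 1) + 1 := by push_cast; ring
  rw [e1, Fs_succ]
  have e2 : (C a : ℝ⟦X⟧) * C a⁻¹ = 1 := by
    rw [← map_mul, mul_inv_cancel₀ ha, map_one]
  rw [map_sub, map_one, show n + 1 + (m + 1) + 1 = n + m + 2 + 1 by ring,
    show n + (m + 1) + 1 = n + m + 2 by ring, show n + 1 + m + 1 = n + m + 2 by ring, pow_succ]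
  linear_combination (-(1 + X) ^ (n + m + 2) * X * Fs a ((s : ℤ) - (n + 1 : ℕ) - 1)) * e2

lemma Gg_rec (a : ℝ) (ha : a ≠ 0) (ha1 : a ≠ 1) (n m s : ℕ) :
    Gg a (n + 1) (m + 1) s = a ^ 2 * Gg a n (m + 1) s + (1 - a) ^ 2 * Gg a (n + 1) m s := by
  have hb : 1 - a ≠ 0 := sub_ne_zero.mpr ha1.symm
  unfold Gg
  rw [Sc_rec a ha, show ((m + 1 : ℕ) : ℤ) - s = (m : ℤ) - s + 1 by push_cast; ring,
    zpow_add_one₀ hb]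
  ring

lemma poch_half_pos (j : ℕ) : 0 < poch (1 / 2) j := by
  unfold poch
  exact Finset.prod_pos (fun i _ => by positivity)

noncomputable def Bb (a : ℝ) (n m k : ℕ) : ℝ :=
  poch (1 / 2) (n + m - k) * poch (1 / 2) k / (poch (1 / 2) n * poch (1 / 2) m) *
    Gg a n m (n + m - k)

lemma Bb_rec (a : ℝ) (ha : a ≠ 0) (ha1 : a ≠ 1) (n m k : ℕ) :
    Bb a (n + 1) (m + 1) (k + 1) * (1 / (2 * k + 1)) =
      a ^ 2 * (1 / (2 * n + 1)) * Bb a n (m + 1) k +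
      (1 - a) ^ 2 * (1 / (2 * m + 1)) * Bb a (n + 1) m k := by
  unfold Bb
  rw [show n + 1 + (m + 1) - (k + 1) = n + m + 1 - k by omega,
    show n + (m + 1) - k = n + m + 1 - k by omega, show n + 1 + m - k = n + m + 1 - k by omega,
    Gg_rec a ha ha1, poch_succ _ k, poch_succ _ n, poch_succ _ m]
  have h1 := (poch_half_pos k).ne'
  have h2 := (poch_half_pos n).ne'
  have h3 := (poch_half_pos m).ne'
  have h4 : (2 * (k : ℝ) + 1) ≠ 0 := by positivity
  have h5 : (2 * (n : ℝ) + 1) ≠ 0 := by positivity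
  have h6 : (2 * (m : ℝ) + 1) ≠ 0 := by positivity
  have e : ∀ x : ℝ, 1 / 2 + x = (2 * x + 1) / 2 := fun x => by ring
  rw [e, e, e]
  generalize poch (1 / 2) (n + m + 1 - k) = P
  generalize poch (1 / 2) k = Pk at *
  generalize poch (1 / 2) n = Pn at *
  generalize poch (1 / 2) m = Pm at *
  field_simp

open PowerSeries in
lemma Bb_zero (a : ℝ) (n m : ℕ) : Bb a (n + 1) (m + 1) 0 = 0 := by
  have : Sc a (n + 1) (m + 1) (n + 1 + (m + 1)) = 0 := by
    unfold Sc
    rw [show ((n + 1 + (m + 1) : ℕ) : ℤ) - (n + 1 : ℕ) - 1 = (m : ℕ) by push_cast; ring, Fs_nat]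
    have h : ((1 + X) ^ (n + 1 + (m + 1) + 1) * (1 + C a⁻¹ * X) ^ m : ℝ⟦X⟧) =
      (((1 + Polynomial.X) ^ (n + 1 + (m + 1) + 1) * (1 + Polynomial.C a⁻¹ * Polynomial.X) ^ m :
        Polynomial ℝ) : ℝ⟦X⟧) := by
      simp
    rw [h, Polynomial.coeff_coe]
    apply Polynomial.coeff_eq_zero_of_natDegree_lt
    have : Polynomial.natDegree ((1 + Polynomial.X) ^ (n + 1 + (m + 1) + 1) *
        (1 + Polynomial.C a⁻¹ * Polynomial.X) ^ m : Polynomial ℝ) ≤ (n + 1 + (m + 1) + 1) * 1 + m * 1 := by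
      refine Polynomial.natDegree_mul_le_of_le ?_ ?_
      · refine Polynomial.natDegree_pow_le_of_le _ ?_
        compute_degree
      · refine Polynomial.natDegree_pow_le_of_le _ ?_
        compute_degree
    omega
  simp [Bb, Gg, this]

open Polynomial in
noncomputable def Pr (a : ℝ) (n m : ℕ) : ℝ[X] :=
  (Qp n).comp (C a * X) * (Qp m).comp (C (1 - a) * X)

open Polynomial in
lemma Qcomp_deriv (a : ℝ) (n : ℕ) : derivative ((Qp (n + 1)).comp (C a * X)) =
    C a * (Qp (n + 1)).comp (C a * X) -
      C (a ^ 2 * (1 / (2 * (n : ℝ) + 1))) * (X * (Qp n).comp (C a * X)) := by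
  rw [derivative_comp, Qp_deriv]
  simp only [sub_comp, mul_comp, C_comp, X_comp, derivative_C_mul, derivative_X, map_mul, map_pow]
  ring

open Polynomial in
lemma Pr_step (a : ℝ) (ha : a ≠ 0) (ha1 : a ≠ 1) (n m : ℕ)
    (h1 : Pr a n (m + 1) = ∑ k ∈ Finset.range (n + m + 2), C (Bb a n (m + 1) k) * Qp k)
    (h2 : Pr a (n + 1) m = ∑ k ∈ Finset.range (n + m + 2), C (Bb a (n + 1) m k) * Qp k) :
    Pr a (n + 1) (m + 1) =
      ∑ k ∈ Finset.range (n + m + 3), C (Bb a (n + 1) (m + 1) k) * Qp k := by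
  rw [← sub_eq_zero]
  apply eq_zero_of_derivative_eq
  have hd : derivative (Pr a (n + 1) (m + 1)) = Pr a (n + 1) (m + 1) -
      X * (C (a ^ 2 * (1 / (2 * (n : ℝ) + 1))) * Pr a n (m + 1) +
        C ((1 - a) ^ 2 * (1 / (2 * (m : ℝ) + 1))) * Pr a (n + 1) m) := by
    simp only [Pr]
    rw [derivative_mul, Qcomp_deriv, Qcomp_deriv, map_sub C 1 a, map_one]
    ring
  rw [derivative_sub, hd, h1, h2, Finset.sum_range_succ' _ (n + m + 2), Bb_zero, C_0, zero_mul, add_zero,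
    derivative_sum, Finset.mul_sum, Finset.mul_sum, ← Finset.sum_add_distrib, Finset.mul_sum]
  rw [sub_sub, sub_right_inj, ← Finset.sum_add_distrib]
  refine Finset.sum_congr rfl (fun k _ => ?_)
  rw [derivative_C_mul, Qp_deriv, ← mul_assoc (C _) (C _), ← mul_assoc (C _) (C _), ← C_mul, ← C_mul, ← add_mul, ← C_add,
    ← Bb_rec a ha ha1, C_mul]
  ring

/-- inverse coefficients -/
noncomputable def dl (l i : ℕ) : ℝ :=
  if i ≤ l ∧ l ≤ 2 * i + 1 then
    ((l + 1).factorial : ℝ) / 2 ^ l * (-1) ^ (l - i) * (2 * i).factorial /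
      ((l - i).factorial * i.factorial * (2 * i + 1 - l).factorial)
  else 0

lemma dl_zero {l i : ℕ} (h : l < i ∨ 2 * i + 1 < l) : dl l i = 0 := by
  rw [dl, if_neg (by omega)]

/-- `l = i + d`, `i + 1 = d + e` -/
lemma dl_eq (i d e : ℕ) (h : i + 1 = d + e) : dl (i + d) i =
    ((i + d + 1).factorial : ℝ) / 2 ^ (i + d) * (-1) ^ d * (2 * i).factorial /
      (d.factorial * i.factorial * e.factorial) := by
  rw [dl, if_pos (by omega), show i + d - i = d by omega, show 2 * i + 1 - (i + d) = e by omega]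

lemma dl_B (l : ℕ) : dl (l + 2) 1 = - 3 * dl l 0 := by
  rcases l with _ | _ | l
  · norm_num [dl, Nat.factorial]
  · norm_num [dl, Nat.factorial]
  · rw [dl_zero (by omega), dl_zero (by omega)]; ring

lemma dl_C (l i : ℕ) : dl (l + 2) (i + 2) = (2 * (i : ℝ) + 3) * (2 * i + 1) * dl l i -
    (2 * (i : ℝ) + 5) * (2 * i + 3) * dl l (i + 1) := by
  rcases lt_trichotomy l i with h | h | h
  · rw [dl_zero (by omega), dl_zero (by omega), dl_zero (by omega)]; ring
  · subst h
    rw [dl_zero (l := l) (i := l + 1) (by omega)]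
    have e1 := dl_eq l 0 (l + 1) (by omega)
    have e2 := dl_eq (l + 2) 0 (l + 3) (by omega)
    rw [add_zero] at e1 e2
    rw [e1, e2, show 2 * (l + 2) = 2 * l + 1 + 1 + 1 + 1 by ring]
    simp only [Nat.factorial_succ, Nat.factorial_zero]
    have h1 := Nat.factorial_ne_zero l
    push_cast
    field_simp
    ring
  · by_cases h2 : 2 * i + 3 < l
    · rw [dl_zero (by omega), dl_zero (by omega), dl_zero (by omega)]; ring
    · obtain ⟨d, rfl⟩ := Nat.exists_eq_add_of_lt h
      have e3 : i + 2 = d + (i + 2 - d) := by omega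
      obtain ⟨e, he⟩ : ∃ e, i + 2 - d = e := ⟨_, rfl⟩
      rw [he] at e3
      have h1 := dl_eq (i + 1) d e (by omega)
      have h2 := dl_eq (i + 2) (d + 1) e (by omega)
      rw [show i + d + 1 + 2 = i + 2 + (d + 1) by ring, h2]
      rw [show i + d + 1 = i + 1 + d by ring, h1]
      have f1 := Nat.factorial_ne_zero i
      have f2 := Nat.factorial_ne_zero d
      have f3 := Nat.factorial_ne_zero e
      have f4 := Nat.factorial_ne_zero (2 * i)
      have hc : (i : ℝ) + 2 = d + e := by exact_mod_cast e3
      rcases e with _ | _ | e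
      · rw [dl_zero (by omega)]
        simp only [show 2 * (i + 2) = 2 * i + 1 + 1 + 1 + 1 by ring,
          show 2 * (i + 1) = 2 * i + 1 + 1 by ring, show i + 2 + (d + 1) + 1 = i + d + 1 + 1 + 1 + 1 by ring,
          show i + 1 + d + 1 = i + d + 1 + 1 by ring, show i + 2 = i + 1 + 1 by ring, Nat.factorial_succ]
        have f5 := Nat.factorial_ne_zero (i + d)
        obtain rfl : d = i + 2 := by omega
        push_cast
        field_simp
        ring
      · rw [dl_zero (by omega)]
        simp only [show 2 * (i + 2) = 2 * i + 1 + 1 + 1 + 1 by ring,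
          show 2 * (i + 1) = 2 * i + 1 + 1 by ring, show i + 2 + (d + 1) + 1 = i + d + 1 + 1 + 1 + 1 by ring,
          show i + 1 + d + 1 = i + d + 1 + 1 by ring, show i + 2 = i + 1 + 1 by ring, Nat.factorial_succ]
        have f5 := Nat.factorial_ne_zero (i + d)
        obtain rfl : d = i + 1 := by omega
        push_cast
        field_simp
        ring
      · rw [show i + 1 + d = i + (d + 1) by ring, dl_eq i (d + 1) e (by omega)]
        simp only [show 2 * (i + 2) = 2 * i + 1 + 1 + 1 + 1 by ring,
          show 2 * (i + 1) = 2 * i + 1 + 1 by ring, show i + 2 + (d + 1) + 1 = i + d + 1 + 1 + 1 + 1 by ring,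
          show i + (d + 1) + 1 = i + d + 1 + 1 by ring, show i + 2 = i + 1 + 1 by ring, Nat.factorial_succ]
        have f5 := Nat.factorial_ne_zero (i + d)
        obtain rfl : i = d + e := by omega
        push_cast
        field_simp
        ring

open Polynomial in
lemma X_pow_step (l : ℕ) (h : (X : ℝ[X]) ^ l = ∑ i ∈ Finset.range (l + 1), C (dl l i) * Qp i) :
    (X : ℝ[X]) ^ (l + 2) = ∑ i ∈ Finset.range (l + 3), C (dl (l + 2) i) * Qp i := by
  rw [show l + 2 = 2 + l by ring, pow_add, h, Finset.mul_sum, show 2 + l = l + 2 by ring,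
    Finset.sum_range_succ' _ (l + 2), Finset.sum_range_succ' _ (l + 1), dl_zero (l := l + 2) (i := 0) (by omega), show 0 + 1 = 1 by rfl, dl_B]
  have e1 : ∀ i ∈ Finset.range (l + 1), X ^ 2 * (C (dl l i) * Qp i) =
      C ((2 * (i : ℝ) + 3) * (2 * i + 1) * dl l i) * Qp (i + 2) -
      C ((2 * (i : ℝ) + 3) * (2 * i + 1) * dl l i) * Qp (i + 1) := by
    intro i _
    rw [mul_left_comm, Qp_rec, C_mul (a := (2 * (i : ℝ) + 3) * (2 * i + 1))]
    ring
  have e2 : ∀ i ∈ Finset.range (l + 1), C (dl (l + 2) (i + 1 + 1)) * Qp (i + 1 + 1) =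
      C ((2 * (i : ℝ) + 3) * (2 * i + 1) * dl l i) * Qp (i + 2) -
      C ((2 * ((i + 1 : ℕ) : ℝ) + 3) * (2 * (i + 1 : ℕ) + 1) * dl l (i + 1)) * Qp (i + 1 + 1) := by
    intro i _
    rw [show i + 1 + 1 = i + 2 by ring, dl_C, ← sub_mul, ← C_sub]
    push_cast
    ring_nf
  rw [Finset.sum_congr rfl e1, Finset.sum_congr rfl e2, Finset.sum_sub_distrib, Finset.sum_sub_distrib]
  have e3 := Finset.sum_range_succ (fun i : ℕ =>
    C ((2 * (i : ℝ) + 3) * (2 * i + 1) * dl l i) * Qp (i + 1)) (l + 1)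
  rw [Finset.sum_range_succ', dl_zero (l := l) (i := l + 1) (by omega), mul_zero, C_0, zero_mul,
    add_zero] at e3
  rw [← e3]
  have e4 : C (-3 * dl l 0) = - C ((2 * ((0 : ℕ) : ℝ) + 3) * (2 * (0 : ℕ) + 1) * dl l 0) := by
    rw [← C_neg]; congr 1; push_cast; ring
  rw [e4]
  simp only [C_0]
  ring

open Polynomial in
lemma X_pow_eq (l : ℕ) : (X : ℝ[X]) ^ l = ∑ i ∈ Finset.range (l + 1), C (dl l i) * Qp i ∧
    (X : ℝ[X]) ^ (l + 1) = ∑ i ∈ Finset.range (l + 2), C (dl (l + 1) i) * Qp i := by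
  induction l with
  | zero =>
    constructor
    · norm_num [dl, Qp, cc]
    · norm_num [dl, Qp, cc, Finset.sum_range_succ, Nat.factorial]
  | succ l ih => exact ⟨ih.2, X_pow_step l ih.1⟩

open Polynomial in
lemma Qcomp_expand (b : ℝ) (m : ℕ) : (Qp m).comp (C b * X) =
    ∑ k ∈ Finset.range (m + 1), C (∑ l ∈ Finset.range (m + 1), cc m l * b ^ l * dl l k) * Qp k := by
  have h : ∀ l ∈ Finset.range (m + 1), C (cc m l) * (C b * X) ^ l =
      ∑ k ∈ Finset.range (m + 1), C (cc m l * b ^ l * dl l k) * Qp k := by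
    intro l hl
    rw [Finset.mem_range] at hl
    rw [mul_pow, (X_pow_eq l).1, ← mul_assoc, ← C_pow, ← C_mul, Finset.mul_sum]
    have : Finset.range (l + 1) ⊆ Finset.range (m + 1) := by
      intro x; simp only [Finset.mem_range]; omega
    rw [Finset.sum_subset this]
    · refine Finset.sum_congr rfl (fun k _ => ?_)
      rw [C_mul (b := dl l k), mul_assoc]
    · intro x _ hx
      rw [Finset.mem_range] at hx
      rw [dl_zero (by omega), C_0]; ring
  have h2 : (Qp m).comp (C b * X) = ∑ l ∈ Finset.range (m + 1), C (cc m l) * (C b * X) ^ l := by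
    rw [Qp, Polynomial.sum_comp]
    simp
  rw [h2, Finset.sum_congr rfl h, Finset.sum_comm]
  refine Finset.sum_congr rfl (fun k _ => ?_)
  rw [map_sum, Finset.sum_mul]

lemma poch_half (j : ℕ) : poch (1 / 2) j = (2 * j).factorial / (4 ^ j * j.factorial) := by
  induction j with
  | zero => simp [poch]
  | succ j ih =>
    rw [poch_succ, ih, show 2 * (j + 1) = 2 * j + 1 + 1 by ring]
    simp only [Nat.factorial_succ]
    have := Nat.factorial_ne_zero j
    push_cast
    field_simp
    ring

open PowerSeries in
lemma coeff_one_add_X_pow' (d j : ℕ) : coeff j ((1 + X : ℝ⟦X⟧) ^ d) = (d.choose j : ℝ) := by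
  have hright : (1 + X : ℝ⟦X⟧) ^ d = (((1 : Polynomial ℝ) + (Polynomial.X)) ^ d : Polynomial ℝ) := by
    simp
  rw [hright, Polynomial.coeff_coe, Polynomial.coeff_one_add_X_pow]

noncomputable def tt (k s i : ℕ) : ℝ := (s.choose i : ℝ) * ((k + 2 * s + 2 - i).choose (2 * s + 2) : ℝ)

open PowerSeries in
lemma Sc_left (a : ℝ) (ha : a ≠ 0) (k s : ℕ) :
    a ^ s * Sc a 0 (k + s + 1) (s + 1) =
      ∑ i ∈ Finset.range (s + 1), tt k s i * (-(1 - a)) ^ i := by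
  unfold Sc
  rw [show ((s + 1 : ℕ) : ℤ) - (0 : ℕ) - 1 = (s : ℕ) by push_cast; ring, Fs_nat, ← coeff_C_mul]
  have e2 : (C a : ℝ⟦X⟧) * C a⁻¹ = 1 := by
    rw [← map_mul, mul_inv_cancel₀ ha, map_one]
  have e3 : (C (a ^ s) : ℝ⟦X⟧) * ((1 + X) ^ (0 + (k + s + 1) + 1) * (1 + C a⁻¹ * X) ^ s) =
      ∑ i ∈ Finset.range (s + 1), C ((s.choose i : ℝ) * (-(1 - a)) ^ i) * (1 + X) ^ (k + 2 * s + 2 - i) := by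
    have e4 : (C (a ^ s) : ℝ⟦X⟧) * (1 + C a⁻¹ * X) ^ s = (C (-(1 - a)) + (1 + X)) ^ s := by
      rw [map_pow, ← mul_pow]
      congr 1
      rw [map_neg, map_sub, map_one]
      linear_combination X * e2
    rw [mul_left_comm, e4, add_pow (C (-(1 - a))) (1 + X) s, Finset.mul_sum]
    refine Finset.sum_congr rfl (fun i hi => ?_)
    rw [Finset.mem_range] at hi
    rw [show k + 2 * s + 2 - i = (0 + (k + s + 1) + 1) + (s - i) by omega, pow_add, map_mul, map_pow, map_natCast]
    ring
  rw [e3, map_sum]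
  refine Finset.sum_congr rfl (fun i hi => ?_)
  rw [coeff_C_mul, coeff_one_add_X_pow', tt, show 2 * (s + 1) = 2 * s + 2 by ring]
  ring

lemma tt_rel (e i f : ℕ) : tt (i + e) (i + f) (i + 1) * ((i + 1) * (e + 2 * (i + f) + 2)) =
    tt (i + e) (i + f) i * (f * e) := by
  unfold tt
  rw [show i + e + 2 * (i + f) + 2 - (i + 1) = e + 2 * (i + f) + 1 by omega,
    show i + e + 2 * (i + f) + 2 - i = e + 2 * (i + f) + 1 + 1 by omega]
  have h1 := Nat.choose_succ_right_eq (i + f) i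
  have h2 := Nat.choose_mul_succ_eq (e + 2 * (i + f) + 1) (2 * (i + f) + 2)
  rw [show i + f - i = f by omega] at h1
  rw [show e + 2 * (i + f) + 1 + 1 - (2 * (i + f) + 2) = e by omega] at h2
  have h1' : (((i + f).choose (i + 1) : ℕ) : ℝ) * (i + 1) = ((i + f).choose i : ℕ) * f := by exact_mod_cast h1
  have h2' : (((e + 2 * (i + f) + 1).choose (2 * (i + f) + 2) : ℕ) : ℝ) * (e + 2 * (i + f) + 1 + 1) =
      ((e + 2 * (i + f) + 1 + 1).choose (2 * (i + f) + 2) : ℕ) * e := by exact_mod_cast h2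
  calc _ = ((((i + f).choose (i + 1) : ℕ) : ℝ) * (i + 1)) *
    ((((e + 2 * (i + f) + 1).choose (2 * (i + f) + 2) : ℕ) : ℝ) * (e + 2 * (i + f) + 1 + 1)) := by ring
    _ = _ := by rw [h1', h2']; ring

lemma tt_val (e i f : ℕ) : tt (i + e) (i + f) i = ((i + f).factorial : ℝ) / (i.factorial * f.factorial) *
    ((2 * i + 2 * f + 2 + e).factorial / ((2 * i + 2 * f + 2).factorial * e.factorial)) := by
  unfold tt
  rw [show i + e + 2 * (i + f) + 2 - i = 2 * i + 2 * f + 2 + e by omega,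
    show 2 * (i + f) + 2 = 2 * i + 2 * f + 2 by ring, Nat.cast_add_choose, Nat.cast_add_choose]

lemma coef_zero (k s : ℕ) : cc (k + s + 1) k * dl k k =
    poch (1 / 2) (s + 1) * poch (1 / 2) k / poch (1 / 2) (k + s + 1) * tt k s 0 := by
  have h1 := tt_val k 0 s
  have h2 := dl_eq k 0 (k + 1) (by omega)
  simp only [zero_add, add_zero, mul_zero] at h1 h2
  rw [h1, h2, poch_half, poch_half, poch_half, show k + s + 1 = k + (s + 1) by ring, cc_add]
  rw [show 2 * (k + (s + 1)) = 2 * k + 2 * s + 1 + 1 by ring,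
    show 2 * k + 2 * (s + 1) = 2 * k + 2 * s + 1 + 1 by ring,
    show k + 2 * (s + 1) = 2 * s + k + 1 + 1 by ring, show 2 * (s + 1) = 2 * s + 1 + 1 by ring,
    show 2 * s + 2 + k = 2 * s + k + 1 + 1 by ring, show 2 * s + 2 = 2 * s + 1 + 1 by ring,
    show k + (s + 1) = k + s + 1 by ring]
  simp only [Nat.factorial_succ, Nat.factorial_zero]
  have f1 := Nat.factorial_ne_zero k
  have f2 := Nat.factorial_ne_zero s
  have f3 := Nat.factorial_ne_zero (k + s)
  have f4 := Nat.factorial_ne_zero (2 * k + 2 * s)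
  have f5 := Nat.factorial_ne_zero (2 * s + k)
  have f6 := Nat.factorial_ne_zero (2 * s)
  have f7 := Nat.factorial_ne_zero (2 * k)
  push_cast
  field_simp
  ring

lemma coef_succ (k s i : ℕ) (hi : i ≤ s) : cc (k + s + 1) (k + (i + 1)) * dl (k + (i + 1)) k =
    poch (1 / 2) (s + 1) * poch (1 / 2) k / poch (1 / 2) (k + s + 1) *
      ((-1) ^ (i + 1) * (tt k s (i + 1) + tt k s i)) := by
  by_cases hk : k < i
  · rw [dl_zero (by omega), tt, tt, Nat.choose_eq_zero_of_lt (show k + 2 * s + 2 - i < 2 * s + 2 by omega),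
      Nat.choose_eq_zero_of_lt (show k + 2 * s + 2 - (i + 1) < 2 * s + 2 by omega)]
    simp
  · obtain ⟨e, rfl⟩ := Nat.exists_eq_add_of_le (not_lt.mp hk)
    obtain ⟨f, rfl⟩ := Nat.exists_eq_add_of_le hi
    have h0 : tt (i + e) (i + f) (i + 1) = tt (i + e) (i + f) i * (f * e) / ((i + 1) * (e + 2 * (i + f) + 2)) := by
      rw [← tt_rel]
      field_simp
    rw [h0, tt_val, dl_eq (i + e) (i + 1) e (by omega), poch_half, poch_half, poch_half,
      show i + e + (i + f) + 1 = i + e + (i + 1) + f by ring, cc_add]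
    rw [show 2 * (i + f + 1) = 2 * i + 2 * f + 1 + 1 by ring,
      show 2 * i + 2 * f + 2 + e = 2 * i + 2 * f + e + 1 + 1 by ring,
      show 2 * i + 2 * f + 2 = 2 * i + 2 * f + 1 + 1 by ring,
      show 2 * (i + e + (i + 1) + f) = 4 * i + 2 * e + 2 * f + 1 + 1 by ring,
      show 2 * (i + e + (i + 1)) + 2 * f = 4 * i + 2 * e + 2 * f + 1 + 1 by ring,
      show i + e + (i + 1) + f = 2 * i + e + f + 1 by ring,
      show i + e + (i + 1) + 2 * f = 2 * i + 2 * f + e + 1 by ring,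
      show i + e + (i + 1) + 1 = 2 * i + e + 1 + 1 by ring,
      show i + e + (i + 1) = 2 * i + e + 1 by ring,
      show 2 * (i + e) = 2 * i + 2 * e by ring]
    simp only [Nat.factorial_succ]
    have f1 := Nat.factorial_ne_zero i
    have f2 := Nat.factorial_ne_zero e
    have f3 := Nat.factorial_ne_zero f
    have f4 := Nat.factorial_ne_zero (i + e)
    have f5 := Nat.factorial_ne_zero (i + f)
    have f6 := Nat.factorial_ne_zero (2 * i + 2 * f)
    have f7 := Nat.factorial_ne_zero (2 * i + 2 * f + e)
    have f8 := Nat.factorial_ne_zero (2 * i + e + f)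
    have f9 := Nat.factorial_ne_zero (2 * i + e)
    have f10 := Nat.factorial_ne_zero (4 * i + 2 * e + 2 * f)
    have f11 := Nat.factorial_ne_zero (2 * i + 2 * e)
    push_cast
    field_simp
    ring

open PowerSeries in
lemma Sc_zero (a : ℝ) (n m : ℕ) : Sc a n m 0 = 1 := by
  simp [Sc, Fs, coeff_rescale, coeff_mul]

lemma base_left (a : ℝ) (ha : a ≠ 0) (m k : ℕ) (hk : k ≤ m) :
    ∑ l ∈ Finset.range (m + 1), cc m l * (1 - a) ^ l * dl l k = Bb a 0 m k := by
  obtain ⟨s, rfl⟩ := Nat.exists_eq_add_of_le hk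
  have hs : ∑ l ∈ Finset.range (k + s + 1), cc (k + s) l * (1 - a) ^ l * dl l k =
      ∑ i ∈ Finset.range (s + 1), cc (k + s) (k + i) * (1 - a) ^ (k + i) * dl (k + i) k := by
    rw [add_assoc k s 1, Finset.sum_range_add, Finset.sum_eq_zero, zero_add]
    intro x hx
    rw [Finset.mem_range] at hx
    rw [dl_zero (by omega), mul_zero]
  have hp0 : poch (1 / 2) 0 = 1 := by simp [poch]
  rw [hs]
  rcases s with _ | s
  · have h2 := dl_eq k 0 (k + 1) (by omega)
    have h3 := cc_add k 0
    simp only [add_zero, mul_zero] at h2 h3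
    have := (poch_half_pos k).ne'
    simp only [zero_add, Finset.sum_range_one, add_zero, Bb, Gg, Nat.sub_self, Sc_zero, hp0, h2, h3,
      Nat.factorial_succ, Nat.factorial_zero]
    have f1 := Nat.factorial_ne_zero k
    have f7 := Nat.factorial_ne_zero (2 * k)
    push_cast
    rw [sub_zero, zpow_natCast]
    field_simp
  · have hG : Gg a 0 (k + s + 1) (s + 1) = (1 - (1 - a)) * (1 - a) ^ k *
        ∑ i ∈ Finset.range (s + 1), tt k s i * (-(1 - a)) ^ i := by
      rw [← Sc_left a ha, Gg, show ((k + s + 1 : ℕ) : ℤ) - (s + 1 : ℕ) = (k : ℕ) by push_cast; ring, zpow_natCast]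
      ring
    rw [Bb, show 0 + (k + (s + 1)) - k = s + 1 by omega, hp0, one_mul, ← add_assoc k s 1, hG,
      Finset.sum_range_succ']
    have e1 : ∀ i ∈ Finset.range (s + 1), cc (k + s + 1) (k + (i + 1)) * (1 - a) ^ (k + (i + 1)) * dl (k + (i + 1)) k =
        poch (1 / 2) (s + 1) * poch (1 / 2) k / poch (1 / 2) (k + s + 1) * (1 - a) ^ k *
          (tt k s (i + 1) * (-(1 - a)) ^ (i + 1) - (1 - a) * (tt k s i * (-(1 - a)) ^ i)) := by
      intro i hi
      rw [Finset.mem_range] at hi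
      have := coef_succ k s i (by omega)
      have e : (-(1 - a)) ^ i = (-1) ^ i * (1 - a) ^ i := by rw [← mul_pow]; ring
      rw [pow_succ (-(1-a)), e]
      linear_combination (1 - a) ^ (k + (i + 1)) * this
    rw [Finset.sum_congr rfl e1, ← Finset.mul_sum, Finset.sum_sub_distrib, ← Finset.mul_sum]
    have e2 := Finset.sum_range_succ' (fun i => tt k s i * (-(1 - a)) ^ i) (s + 1)
    rw [Finset.sum_range_succ, show tt k s (s + 1) = 0 by simp [tt]] at e2
    have e3 := coef_zero k s
    rw [add_zero]
    linear_combination (1 - a) ^ k * e3 - poch (1 / 2) (s + 1) * poch (1 / 2) k / poch (1 / 2) (k + s + 1) * (1 - a) ^ k * e2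

lemma choose_sym (s r : ℕ) (hr : r ≤ 2 * (s + 1)) :
    ((Ring.choose (((s + 1 : ℕ) : ℤ) - r) (2 * (s + 1) - r) : ℤ) : ℝ) =
      (-1) ^ r * (s.choose (2 * (s + 1) - r) : ℝ) := by
  by_cases h : r ≤ s + 1
  · rw [show ((s + 1 : ℕ) : ℤ) - r = ((s + 1 - r : ℕ) : ℤ) by push_cast [h]; ring, Ring.choose_natCast,
      Nat.choose_eq_zero_of_lt (by omega), Nat.choose_eq_zero_of_lt (by omega)]
    simp
  · obtain ⟨c, rfl⟩ := Nat.exists_eq_add_of_lt (not_le.mp h)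
    obtain ⟨d, rfl⟩ := Nat.exists_eq_add_of_le (show c ≤ s by omega)
    rw [show 2 * (c + d + 1) - (c + d + 1 + c + 1) = d by omega,
      show ((c + d + 1 : ℕ) : ℤ) - (c + d + 1 + c + 1 : ℕ) = -((c + 1 : ℕ) : ℤ) by push_cast; ring,
      Ring.choose_neg, show ((c + 1 : ℕ) : ℤ) + d - 1 = ((c + d : ℕ) : ℤ) by push_cast; ring,
      Ring.choose_natCast, Units.smul_def, smul_eq_mul]
    rw [show c + d + 1 + c + 1 = d + 2 * (c + 1) by ring, pow_add, pow_mul]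
    simp [Int.negOnePow]

open PowerSeries in
lemma Sc_right (a : ℝ) (ha : a ≠ 0) (n s : ℕ) :
    a ^ (2 * (s + 1)) * Sc a n 0 (s + 1) =
      ∑ r ∈ Finset.range (2 * (s + 1) + 1),
        ((n + 1).choose r : ℝ) * (1 - a) ^ r * (s.choose (2 * (s + 1) - r) : ℝ) := by
  unfold Sc
  rw [← coeff_rescale, map_mul, map_pow, map_add, map_one, rescale_X, Fs, rescale_rescale,
    inv_mul_cancel₀ ha, rescale_one, RingHom.id_apply, add_zero]
  have e1 : (1 + C a * X : ℝ⟦X⟧) = C (-(1 - a)) * X + (1 + X) := by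
    rw [map_neg, map_sub, map_one]; ring
  rw [e1, add_pow, Finset.sum_mul, map_sum]
  have e2 : ∀ r ∈ Finset.range (n + 1 + 1),
      coeff (2 * (s + 1)) ((C (-(1 - a)) * X) ^ r * (1 + X) ^ (n + 1 - r) * ((n + 1).choose r : ℝ⟦X⟧) *
        binomialSeries ℝ (((s + 1 : ℕ) : ℤ) - n - 1)) =
      if r ≤ 2 * (s + 1) then ((n + 1).choose r : ℝ) * (1 - a) ^ r * (s.choose (2 * (s + 1) - r) : ℝ) else 0 := by
    intro r hr
    rw [Finset.mem_range] at hr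
    have e3 : ((C (-(1 - a)) * X) ^ r * (1 + X) ^ (n + 1 - r) * ((n + 1).choose r : ℝ⟦X⟧) *
        binomialSeries ℝ (((s + 1 : ℕ) : ℤ) - n - 1)) =
        C ((-(1 - a)) ^ r * ((n + 1).choose r : ℝ)) * (X ^ r * binomialSeries ℝ (((s + 1 : ℕ) : ℤ) - r)) := by
      rw [show ((s + 1 : ℕ) : ℤ) - r = ((n + 1 - r : ℕ) : ℤ) + (((s + 1 : ℕ) : ℤ) - n - 1) by
        push_cast [show r ≤ n + 1 by omega]; ring, binomialSeries_add, binomialSeries_nat, map_mul, map_pow,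
        map_natCast]
      ring
    rw [e3, coeff_C_mul, coeff_X_pow_mul']
    split_ifs with h
    · rw [binomialSeries_coeff, zsmul_eq_mul, mul_one, choose_sym s r h]
      have : (-(1 - a)) ^ r = (-1) ^ r * (1 - a) ^ r := by rw [← mul_pow]; ring
      have h1 : ((-1 : ℝ) ^ r) * (-1) ^ r = 1 := by rw [← mul_pow]; simp
      rw [this]
      linear_combination (1 - a) ^ r * ((n + 1).choose r : ℝ) * (s.choose (2 * (s + 1) - r) : ℝ) * h1
    · ring
  rw [Finset.sum_congr rfl e2]
  have e5 : ∀ r ∈ Finset.range (2 * (s + 1) + 1),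
      ((n + 1).choose r : ℝ) * (1 - a) ^ r * (s.choose (2 * (s + 1) - r) : ℝ) =
      if r ≤ 2 * (s + 1) then ((n + 1).choose r : ℝ) * (1 - a) ^ r * (s.choose (2 * (s + 1) - r) : ℝ) else 0 := by
    intro r hr
    rw [Finset.mem_range] at hr
    rw [if_pos (by omega)]
  rw [Finset.sum_congr rfl e5]
  have s1 : Finset.range (n + 1 + 1) ⊆ Finset.range (n + 1 + 1 + (2 * (s + 1) + 1)) := by
    intro x; simp only [Finset.mem_range]; omega
  have s2 : Finset.range (2 * (s + 1) + 1) ⊆ Finset.range (n + 1 + 1 + (2 * (s + 1) + 1)) := by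
    intro x; simp only [Finset.mem_range]; omega
  rw [Finset.sum_subset s1, Finset.sum_subset s2]
  · intro x _ hx
    rw [Finset.mem_range] at hx
    rw [if_neg (by omega)]
  · intro x _ hx
    rw [Finset.mem_range] at hx
    rw [Nat.choose_eq_zero_of_lt (show n + 1 < x by omega)]
    simp

open PowerSeries in
lemma Sc_left2 (b : ℝ) (hb : b ≠ 0) (n s : ℕ) :
    b ^ (s + 2) * (b ^ s * Sc b 0 n (s + 1)) =
      ∑ r ∈ Finset.range (2 * (s + 1) + 1),
        ((n + 1).choose r : ℝ) * b ^ r * (s.choose (2 * (s + 1) - r) : ℝ) := by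
  unfold Sc
  rw [show ((s + 1 : ℕ) : ℤ) - (0 : ℕ) - 1 = (s : ℕ) by push_cast; ring, Fs_nat, ← coeff_C_mul]
  have e2 : (C b : ℝ⟦X⟧) * C b⁻¹ = 1 := by
    rw [← map_mul, mul_inv_cancel₀ hb, map_one]
  have e4 : (C (b ^ s) : ℝ⟦X⟧) * (1 + C b⁻¹ * X) ^ s = (X + C b) ^ s := by
    rw [map_pow, ← mul_pow]
    congr 1
    linear_combination X * e2
  rw [mul_left_comm, e4, add_pow X (C b) s, Finset.mul_sum, map_sum, Finset.mul_sum]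
  rw [← Finset.sum_range_reflect _ (2 * (s + 1) + 1)]
  have s1 : Finset.range (s + 1) ⊆ Finset.range (2 * (s + 1) + 1) := by
    intro x; simp only [Finset.mem_range]; omega
  rw [← Finset.sum_subset s1]
  · refine Finset.sum_congr rfl (fun i hi => ?_)
    rw [Finset.mem_range] at hi
    rw [show ((1 + X) ^ (0 + n + 1) * (X ^ i * (C b) ^ (s - i) * (s.choose i : ℝ⟦X⟧)) : ℝ⟦X⟧) =
      C (b ^ (s - i) * (s.choose i : ℝ)) * (X ^ i * (1 + X) ^ (n + 1)) by
        rw [map_mul, map_pow, map_natCast, zero_add]; ring, coeff_C_mul, coeff_X_pow_mul', if_pos (by omega),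
        coeff_one_add_X_pow', show 2 * (s + 1) + 1 - 1 - i = 2 * (s + 1) - i by omega,
        show 2 * (s + 1) - (2 * (s + 1) - i) = i by omega,
        show 2 * (s + 1) - i = (s + 2) + (s - i) by omega, pow_add b]
    ring
  · intro x hx hx2
    rw [Finset.mem_range] at hx hx2
    rw [Nat.choose_eq_zero_of_lt (show s < 2 * (s + 1) - (2 * (s + 1) + 1 - 1 - x) by omega)]
    simp

lemma Gg_sym (a : ℝ) (ha : a ≠ 0) (ha1 : a ≠ 1) (n s : ℕ) :
    Gg a n 0 s = Gg (1 - a) 0 n s := by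
  have hb : 1 - a ≠ 0 := sub_ne_zero.mpr ha1.symm
  unfold Gg
  rcases s with _ | s
  · simp [Sc_zero]
  · have h1 := Sc_right a ha n s
    rw [← Sc_left2 (1 - a) hb] at h1
    rw [show 1 - (1 - a) = a by ring, zpow_sub₀ hb, zpow_sub₀ ha]
    simp only [zpow_natCast, pow_zero]
    field_simp
    linear_combination a ^ n * h1

lemma Bb_sym (a : ℝ) (ha : a ≠ 0) (ha1 : a ≠ 1) (n k : ℕ) :
    Bb a n 0 k = Bb (1 - a) 0 n k := by
  unfold Bb
  rw [zero_add, add_zero, Gg_sym a ha ha1, mul_comm (poch (1 / 2) n)]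

open Polynomial in
lemma Pr_eq (a : ℝ) (ha : a ≠ 0) (ha1 : a ≠ 1) (N : ℕ) : ∀ n m : ℕ, n + m = N →
    Pr a n m = ∑ k ∈ Finset.range (n + m + 1), C (Bb a n m k) * Qp k := by
  have hb : 1 - a ≠ 0 := sub_ne_zero.mpr ha1.symm
  have hQ0 : Qp 0 = 1 := by simp [Qp, cc]
  induction N with
  | zero =>
    intro n m h
    obtain ⟨rfl, rfl⟩ : n = 0 ∧ m = 0 := by omega
    simp [Pr, hQ0, Bb, Gg, Sc_zero, poch]
  | succ N ih =>
    intro n m h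
    rcases n with _ | n
    · rw [Pr, hQ0, one_comp, one_mul, Qcomp_expand, zero_add]
      refine Finset.sum_congr rfl (fun k hk => ?_)
      rw [Finset.mem_range] at hk
      rw [base_left a ha m k (by omega)]
    · rcases m with _ | m
      · rw [Pr, hQ0, one_comp, mul_one, Qcomp_expand, add_zero]
        refine Finset.sum_congr rfl (fun k hk => ?_)
        rw [Finset.mem_range] at hk
        have := base_left (1 - a) hb (n + 1) k (by omega)
        rw [show 1 - (1 - a) = a by ring] at this
        rw [this, Bb_sym a ha ha1]
      · have h1 := ih n (m + 1) (by omega)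
        have h2 := ih (n + 1) m (by omega)
        rw [show n + (m + 1) + 1 = n + m + 2 by ring] at h1
        rw [show n + 1 + m + 1 = n + m + 2 by ring] at h2
        rw [show n + 1 + (m + 1) + 1 = n + m + 3 by ring]
        exact Pr_step a ha ha1 n m h1 h2

lemma choose_poch (z : ℤ) (j : ℕ) : ((Ring.choose z j : ℤ) : ℝ) = (-1) ^ j * poch (-z) j / j.factorial := by
  have h : ((Ring.choose z j : ℤ) : ℝ) = Ring.choose (z : ℝ) j := by
    exact Ring.map_choose (Int.castRingHom ℝ) z j
  rw [h, Ring.choose_eq_smul, Polynomial.descPochhammer_smeval_eq_ascPochhammer,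
    Polynomial.ascPochhammer_smeval_eq_eval, ← descPochhammer_eval_eq_ascPochhammer,
    descPochhammer_eval_eq_prod_range, poch, smul_eq_mul]
  have : ∏ i ∈ Finset.range j, ((z : ℝ) - i) = (-1) ^ j * ∏ i ∈ Finset.range j, (-(z : ℝ) + i) := by
    rw [show ((-1 : ℝ) ^ j) = ∏ i ∈ Finset.range j, (-1 : ℝ) by simp,
      ← Finset.prod_mul_distrib]
    refine Finset.prod_congr rfl (fun i _ => ?_)
    ring
  rw [this]
  ring

lemma choose_shift (M q j : ℕ) (hq : q ≤ M) (hj : j ≤ q) :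
    (M.choose (q - j) : ℝ) * poch ((M : ℝ) - q + 1) j = M.choose q * ((-1) ^ j * poch (-q) j) := by
  induction j with
  | zero => simp [poch]
  | succ j ih =>
    have ih := ih (by omega)
    rw [poch_succ, poch_succ]
    have h := Nat.choose_succ_right_eq M (q - (j + 1))
    rw [show q - (j + 1) + 1 = q - j by omega] at h
    have h' : (M.choose (q - j) : ℝ) * ((q - j : ℕ) : ℝ) = M.choose (q - (j + 1)) * ((M - (q - (j + 1)) : ℕ) : ℝ) := by
      exact_mod_cast h
    rw [Nat.cast_sub (by omega : j ≤ q), Nat.cast_sub (by omega : q - (j + 1) ≤ M), Nat.cast_sub hj] at h'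
    push_cast at h'
    rw [pow_succ]
    linear_combination (-(poch ((M : ℝ) - q + 1) j)) * h' + ((q : ℝ) - j) * ih

open PowerSeries in
lemma Sc_final (a : ℝ) (n m s : ℕ) (h : 2 * s ≤ n + m + 1) :
    Sc a n m s = ((n + m + 1).choose (2 * s) : ℝ) * ∑ j ∈ Finset.range (2 * s + 1),
      poch (-(2 * s : ℕ)) j * poch ((n : ℝ) - s + 1) j /
          (poch (((n + m + 1 : ℕ) : ℝ) - (2 * s : ℕ) + 1) j * j.factorial) * a ^ (-(j : ℤ)) := by
  unfold Sc
  rw [mul_comm ((1 + X) ^ (n + m + 1)), coeff_mul, Finset.Nat.sum_antidiagonal_eq_sum_range_succ_mk, Finset.mul_sum]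
  refine Finset.sum_congr rfl (fun j hj => ?_)
  rw [Finset.mem_range] at hj
  rw [coeff_one_add_X_pow', Fs, coeff_rescale, binomialSeries_coeff, zsmul_eq_mul, mul_one, choose_poch]
  have h1 := choose_shift (n + m + 1) (2 * s) j h (by omega)
  have h2 : 0 < poch (((n + m + 1 : ℕ) : ℝ) - (2 * s : ℕ) + 1) j := by
    unfold poch
    refine Finset.prod_pos (fun i _ => ?_)
    have : ((2 * s : ℕ) : ℝ) ≤ ((n + m + 1 : ℕ) : ℝ) := by exact_mod_cast h
    have hi : (0 : ℝ) ≤ i := Nat.cast_nonneg i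
    linarith
  have h2' := h2.ne'
  rw [show (-(((s : ℤ) - n - 1 : ℤ) : ℝ)) = (n : ℝ) - s + 1 by push_cast; ring, zpow_neg, zpow_natCast, inv_pow]
  have h3 : ((-1 : ℝ) ^ j) * (-1) ^ j = 1 := by rw [← mul_pow]; simp
  have h4 : ((n + m + 1).choose (2 * s - j) : ℝ) = (n + m + 1).choose (2 * s) * ((-1) ^ j * poch (-(2 * s : ℕ)) j) /
      poch (((n + m + 1 : ℕ) : ℝ) - (2 * s : ℕ) + 1) j := by
    rw [← h1, mul_div_assoc, div_self h2', mul_one]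
  simp only
  rw [h4]
  generalize poch (((n + m + 1 : ℕ) : ℝ) - (2 * s : ℕ) + 1) j = P at *
  have h5 := Nat.factorial_ne_zero j
  linear_combination ((a ^ j)⁻¹ * poch ((n : ℝ) - s + 1) j / j.factorial * ((n + m + 1).choose (2 * s) : ℝ) *
    poch (-(2 * s : ℕ)) j / P) * h3

theorem bessel_linearization_upper_2F1
    (n m : ℕ) (a : ℝ) (ha : a ≠ 0) (ha1 : a ≠ 1)
    (β : ℕ → ℝ)
    (hβ : ∀ u : ℝ, besselQ n (a * u) * besselQ m ((1 - a) * u) =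
      ∑ k ∈ Finset.range (n + m + 1), β k * besselQ k u)
    (k : ℕ) (hk : (n + m - 1 + 1) / 2 ≤ k) (hk2 : k ≤ n + m) :
    β k = a ^ (2 * n + m - k) * (1 - a) ^ ((k : ℤ) - n) *
      (poch (1/2) (n + m - k) * poch (1/2) k) / (poch (1/2) n * poch (1/2) m) *
      ((n + m + 1).choose (2 * (n + m - k))) *
      ∑ j ∈ Finset.range (2 * (n + m - k) + 1),
        poch (2 * (k : ℝ) - 2 * n - 2 * m) j * poch ((k : ℝ) - m + 1) j /
          (poch (2 * (k : ℝ) - m - n + 2) j * j.factorial) * a ^ (-(j : ℤ)) := by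
  have hp : ∑ k ∈ Finset.range (n + m + 1), Polynomial.C (β k - Bb a n m k) * Qp k = 0 := by
    have h1 := Pr_eq a ha ha1 (n + m) n m rfl
    have h2 : Pr a n m = ∑ k ∈ Finset.range (n + m + 1), Polynomial.C (β k) * Qp k := by
      apply Polynomial.funext
      intro u
      simp only [Pr, Polynomial.eval_mul, Polynomial.eval_comp, Polynomial.eval_finsetSum,
        Polynomial.eval_C, Polynomial.eval_X, eval_Qp]
      exact hβ u
    simp only [map_sub, sub_mul, Finset.sum_sub_distrib]
    rw [← h1, ← h2, sub_self]
  have hB := sub_eq_zero.mp (Qp_indep _ _ hp k (by omega))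
  obtain ⟨s, hs⟩ : ∃ s, n + m - k = s := ⟨_, rfl⟩
  have hks : n + m = k + s := by omega
  have hksR : (n : ℝ) + m = k + s := by exact_mod_cast hks
  have hksZ : (n : ℤ) + m = k + s := by exact_mod_cast hks
  rw [hB, Bb, Gg, hs, Sc_final a n m s (by omega), show 2 * n + m - k = n + s by omega,
    show (k : ℤ) - n = m - s by linarith,
    show 2 * (k : ℝ) - 2 * n - 2 * m = -(2 * s : ℕ) by push_cast; linarith,
    show (k : ℝ) - m + 1 = n - s + 1 by linarith,
    show 2 * (k : ℝ) - m - n + 2 = ((n + m + 1 : ℕ) : ℝ) - (2 * s : ℕ) + 1 by push_cast; linarith]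
  ring
end

section
/- (Berg–Vignat boundary case) Let n be a natural number and a a real number. Then β_n^{(n,0)}(a) = a^n, and for every k with 0 ≤ k ≤ n−1, β_k^{(n,0)}(a) = a^k (1−a) · (C(n,k)/C(2n,2k)) · Σ_{j=0}^{min(n−k−1, k)} C(n+1, k−j) C(n−k−1, j) (1−a)^j, where C denotes the usual binomial coefficient. -/
open Finset

noncomputable def bL (a : ℝ) (p q N : ℕ) : ℝ :=
  ∑ r ∈ range (N + 1), (-a) ^ r * (p.choose r : ℝ) * ((p + q + N - r).choose (p + q) : ℝ)

noncomputable def bR (a : ℝ) (p q N : ℕ) : ℝ :=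
  ∑ s ∈ range (N + 1), (p.choose s : ℝ) * (1 - a) ^ s * ((q + N).choose (q + s) : ℝ)

lemma bL_succ (a : ℝ) (p q N : ℕ) :
    bL a (p + 1) q (N + 1) = bL a p (q + 1) (N + 1) - a * bL a p (q + 1) N := by
  unfold bL
  rw [Finset.sum_range_succ' _ (N + 1), Finset.sum_range_succ' _ (N + 1), mul_sum,
    add_sub_right_comm, ← sum_sub_distrib]
  congr 1
  · apply sum_congr rfl
    intro r hr
    rw [Nat.choose_succ_succ, show p + 1 + q + (N + 1) - (r + 1) = p + (q + 1) + N - r by omega,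
      show p + (q + 1) + (N + 1) - (r + 1) = p + (q + 1) + N - r by omega,
      show p + 1 + q = p + (q + 1) by omega]
    push_cast
    ring
  · simp [show p + 1 + q = p + (q + 1) by omega]

lemma bR_succ (a : ℝ) (p q N : ℕ) :
    bR a (p + 1) q (N + 1) = bR a p (q + 1) (N + 1) - a * bR a p (q + 1) N := by
  have h1 : bR a (p + 1) q (N + 1) = bR a p q (N + 1) + (1 - a) * bR a p (q + 1) N := by
    unfold bR
    rw [Finset.sum_range_succ' _ (N + 1), Finset.sum_range_succ' _ (N + 1), mul_sum,
      add_right_comm, ← sum_add_distrib]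
    congr 1
    · apply sum_congr rfl
      intro r hr
      rw [Nat.choose_succ_succ, show q + 1 + N = q + (N + 1) by omega,
        show q + 1 + r = q + (r + 1) by omega]
      push_cast
      ring
    · simp
  have h2 : bR a p (q + 1) (N + 1) = bR a p q (N + 1) + bR a p (q + 1) N := by
    have h3 : bR a p (q + 1) N = ∑ s ∈ range (N + 1 + 1),
        (p.choose s : ℝ) * (1 - a) ^ s * ((q + 1 + N).choose (q + 1 + s) : ℝ) := by
      rw [Finset.sum_range_succ, Nat.choose_eq_zero_of_lt (show q + 1 + N < q + 1 + (N + 1) by omega)]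
      simp [bR]
    rw [h3]
    unfold bR
    rw [← sum_add_distrib]
    apply sum_congr rfl
    intro r hr
    rw [show q + 1 + (N + 1) = (q + N + 1) + 1 by omega, show q + 1 + r = (q + r) + 1 by omega,
      Nat.choose_succ_succ, show q + 1 + N = q + N + 1 by omega,
      show q + (N + 1) = q + N + 1 by omega]
    push_cast
    ring
  rw [h1, h2]; ring

lemma bL_eq_bR (a : ℝ) (p : ℕ) : ∀ q N, bL a p q N = bR a p q N := by
  induction p with
  | zero =>
    intro q N
    unfold bL bR
    rw [sum_range_succ', sum_range_succ']
    simp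
  | succ p ih =>
    intro q N
    cases N with
    | zero => simp [bL, bR]
    | succ N => rw [bL_succ, bR_succ, ih, ih]

lemma weighted (a : ℝ) (p q N : ℕ) :
    ∑ r ∈ range (N + 2), (-a) ^ r * ((p : ℝ) + 1 + r) * ((p + 1).choose r : ℝ) *
      ((p + 1 + q + (N + 1) - r).choose (p + 1 + q) : ℝ) =
    (p + 1) * (bL a (p + 1) q (N + 1) - a * bL a p (q + 1) N) := by
  unfold bL
  rw [Finset.sum_range_succ' _ (N + 1), Finset.sum_range_succ' _ (N + 1), mul_sum,
    add_sub_right_comm, ← sum_sub_distrib, mul_add ((p : ℝ) + 1), mul_sum]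
  congr 1
  · apply sum_congr rfl
    intro r hr
    rw [show p + 1 + q + (N + 1) - (r + 1) = p + (q + 1) + N - r by omega,
      show p + 1 + q = p + (q + 1) by omega]
    have h : ((p : ℝ) + 1) * (p.choose r : ℝ) = ((p + 1).choose (r + 1) : ℝ) * (r + 1) := by
      exact_mod_cast Nat.add_one_mul_choose_eq p r
    push_cast
    rw [pow_succ]
    linear_combination (-a) ^ r * a * ((p + (q + 1) + N - r).choose (p + (q + 1)) : ℝ) * h
  · simp

lemma term_id (j x y : ℕ) :
    (((j + y + 1).factorial : ℝ) * (2 * j + x + y + 1).factorial) *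
     (((j + x + 1).choose (j + 1) : ℝ) * ((2 * (j + y) + 1).choose (j + y + 1 + j))
      - ((j + x).choose (j + 1) : ℝ) * ((2 * (j + y) + 1).choose (j + y + 2 + j))
      + ((j + x).choose j : ℝ) * ((2 * (j + y) + 1).choose (j + y + 1 + j)))
    = (j + x).factorial * (2 * (j + y + 1)).factorial *
      (((2 * j + x + y + 2).choose x : ℝ) * ((j + y).choose j)) := by
  have e1 : ((j + x + 1).choose (j + 1) : ℝ) * (j + 1) = (j + x + 1) * (j + x).choose j := by
    exact_mod_cast (Nat.add_one_mul_choose_eq (j + x) j).symm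
  have e2 : ((j + x).choose (j + 1) : ℝ) * (j + 1) = (j + x).choose j * x := by
    have := Nat.choose_succ_right_eq (j + x) j
    rw [show j + x - j = x by omega] at this
    exact_mod_cast this
  have e3 : ((2 * (j + y) + 1).choose (j + y + 2 + j) : ℝ) * (j + y + 2 + j)
      = (2 * (j + y) + 1).choose (j + y + 1 + j) * y := by
    have := Nat.choose_succ_right_eq (2 * (j + y) + 1) (j + y + 1 + j)
    rw [show 2 * (j + y) + 1 - (j + y + 1 + j) = y by omega,
      show j + y + 1 + j + 1 = j + y + 2 + j by omega] at this
    exact_mod_cast this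
  have f1 : ((j + x).choose j : ℝ) = (j + x).factorial / (j.factorial * x.factorial) := by
    rw [Nat.cast_choose ℝ (by omega), show j + x - j = x by omega]
  have f2 : ((j + y).choose j : ℝ) = (j + y).factorial / (j.factorial * y.factorial) := by
    rw [Nat.cast_choose ℝ (by omega), show j + y - j = y by omega]
  have f3 : ((2 * (j + y) + 1).choose (j + y + 1 + j) : ℝ)
      = (2 * (j + y) + 1).factorial / ((j + y + 1 + j).factorial * y.factorial) := by
    rw [Nat.cast_choose ℝ (by omega), show 2 * (j + y) + 1 - (j + y + 1 + j) = y by omega]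
  have f4 : ((2 * j + x + y + 2).choose x : ℝ)
      = (2 * j + x + y + 2).factorial / (x.factorial * (j + y + 1 + j + 1).factorial) := by
    rw [Nat.cast_choose ℝ (by omega), show 2 * j + x + y + 2 - x = j + y + 1 + j + 1 by omega]
  have hj : ((j : ℝ) + 1) ≠ 0 := by positivity
  have hy : ((j : ℝ) + y + 2 + j) ≠ 0 := by positivity
  rw [← eq_div_iff hj] at e1 e2
  rw [← eq_div_iff hy] at e3
  rw [e1, e2, e3, f4, f1, f2, f3, Nat.factorial_succ (j + y + 1 + j), Nat.factorial_succ (j + y),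
    show 2 * j + x + y + 2 = 2 * j + x + y + 1 + 1 by omega, Nat.factorial_succ (2 * j + x + y + 1),
    show 2 * (j + y + 1) = 2 * (j + y) + 1 + 1 by omega, Nat.factorial_succ (2 * (j + y) + 1)]
  have := Nat.factorial_ne_zero x
  have := Nat.factorial_ne_zero y
  have := Nat.factorial_ne_zero j
  have := Nat.factorial_ne_zero (j + y + 1 + j)
  have hh : (j : ℝ) + y + 1 + j + 1 ≠ 0 := by positivity
  push_cast
  generalize ((j + y + 1 + j).factorial : ℝ) = A at *
  field_simp
  ring

lemma bracket (a : ℝ) (k m : ℕ) :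
    bR a (k + 1) m (m + 1) - a * bR a k (m + 1) m = (1 - a) * ∑ j ∈ range (m + 1), (1 - a) ^ j *
     (((k + 1).choose (j + 1) : ℝ) * ((2 * m + 1).choose (m + 1 + j))
      - (k.choose (j + 1) : ℝ) * ((2 * m + 1).choose (m + 2 + j))
      + (k.choose j : ℝ) * ((2 * m + 1).choose (m + 1 + j))) := by
  have h3 : bR a k (m + 1) m = ∑ s ∈ range (m + 1 + 1),
      (k.choose s : ℝ) * (1 - a) ^ s * ((m + 1 + m).choose (m + 1 + s) : ℝ) := by
    rw [Finset.sum_range_succ, Nat.choose_eq_zero_of_lt (show m + 1 + m < m + 1 + (m + 1) by omega)]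
    simp [bR]
  have h : bR a (k + 1) m (m + 1) - a * bR a k (m + 1) m
      = bR a (k + 1) m (m + 1) - bR a k (m + 1) m + (1 - a) * bR a k (m + 1) m := by ring
  rw [h]
  conv_lhs => enter [1, 2]; rw [h3]
  unfold bR
  rw [sum_range_succ' _ (m + 1), sum_range_succ' _ (m + 1)]
  have hs : (m + (m + 1)).choose (m + 0) = (m + 1 + m).choose (m + 1 + 0) := by
    rw [add_zero, add_zero, add_comm m (m + 1), Nat.choose_symm_add]
  rw [hs, Nat.choose_zero_right, Nat.choose_zero_right, add_sub_add_right_eq_sub, ← sum_sub_distrib,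
    mul_sum, mul_sum, ← sum_add_distrib]
  apply sum_congr rfl
  intro j hj
  rw [show m + (m + 1) = 2 * m + 1 by omega, show m + 1 + m = 2 * m + 1 by omega,
    show m + (j + 1) = m + 1 + j by omega, show m + 1 + (j + 1) = m + 2 + j by omega]
  ring

lemma key_sum (a : ℝ) (k m : ℕ) :
    (((m + 1).factorial : ℝ) * (k + m + 1).factorial) *
    ∑ r ∈ range (m + 2), (-a) ^ r * ((k : ℝ) + 1 + r) * ((k + 1).choose r : ℝ) *
      ((k + 1 + m + (m + 1) - r).choose (k + 1 + m) : ℝ) =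
    (k + 1).factorial * (2 * (m + 1)).factorial * ((1 - a) *
      ∑ j ∈ range (min m k + 1), ((k + m + 1 + 1).choose (k - j) : ℝ) * (m.choose j) *
        (1 - a) ^ j) := by
  rw [weighted, bL_eq_bR, bL_eq_bR, bracket]
  have hr : ∑ j ∈ range (m + 1), (1 - a) ^ j *
     (((k + 1).choose (j + 1) : ℝ) * ((2 * m + 1).choose (m + 1 + j))
      - (k.choose (j + 1) : ℝ) * ((2 * m + 1).choose (m + 2 + j))
      + (k.choose j : ℝ) * ((2 * m + 1).choose (m + 1 + j))) =
    ∑ j ∈ range (min m k + 1), (1 - a) ^ j *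
     (((k + 1).choose (j + 1) : ℝ) * ((2 * m + 1).choose (m + 1 + j))
      - (k.choose (j + 1) : ℝ) * ((2 * m + 1).choose (m + 2 + j))
      + (k.choose j : ℝ) * ((2 * m + 1).choose (m + 1 + j))) := by
    symm
    apply sum_subset
    · intro j hj
      simp only [mem_range] at *
      omega
    · intro j hj hj'
      simp only [mem_range] at *
      rw [Nat.choose_eq_zero_of_lt (show k + 1 < j + 1 by omega),
        Nat.choose_eq_zero_of_lt (show k < j + 1 by omega),
        Nat.choose_eq_zero_of_lt (show k < j by omega)]
      simp
  rw [hr]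
  simp only [mul_sum]
  apply sum_congr rfl
  intro j hj
  simp only [mem_range] at hj
  obtain ⟨x, rfl⟩ := Nat.exists_eq_add_of_le (show j ≤ k by omega)
  obtain ⟨y, rfl⟩ := Nat.exists_eq_add_of_le (show j ≤ m by omega)
  have := term_id j x y
  rw [show j + x - j = x by omega, Nat.factorial_succ (j + x),
    show j + x + (j + y) + 1 = 2 * j + x + y + 1 by omega]
  push_cast at this ⊢
  linear_combination ((j : ℝ) + x + 1) * (1 - a) * (1 - a) ^ j * this

noncomputable def bC (k l : ℕ) : ℝ := (k.choose l : ℝ) * (2 * k - l).factorial / (2 * k).factorial * 2 ^ l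

noncomputable def bD (i k : ℕ) : ℝ :=
  (-1) ^ (i + k) * (i + 1) / 2 ^ i * i.choose k * (2 * k + 1).descFactorial i / (2 * k + 1)

lemma besselQ_eq (n k : ℕ) (h : k ≤ n) (u : ℝ) :
    besselQ k u = ∑ l ∈ range (n + 1), bC k l * u ^ l := by
  have h1 : besselQ k u = ∑ l ∈ range (k + 1), bC k l * u ^ l := by
    unfold besselQ
    apply sum_congr rfl
    intro l hl
    simp only [mem_range] at hl
    unfold bC
    rw [Nat.cast_choose ℝ (show l ≤ k by omega)]
    have := Nat.factorial_ne_zero l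
    have := Nat.factorial_ne_zero (k - l)
    field_simp
  rw [h1]
  apply sum_subset
  · intro j hj
    simp only [mem_range] at *
    omega
  · intro j hj hj'
    simp only [mem_range] at *
    simp [bC, Nat.choose_eq_zero_of_lt (show k < j by omega)]

lemma alt_sum (m l : ℕ) :
    ∑ t ∈ range (m + 1 + 1), (-1 : ℝ) ^ (m + 1 - t) * ((m + 1).choose t : ℝ) *
      ((2 * t + l).descFactorial m : ℝ) = 0 := by
  let P : Polynomial ℝ := (descPochhammer ℝ m).comp (Polynomial.C 2 * Polynomial.X + Polynomial.C (l : ℝ))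
  have hP : P.natDegree < m + 1 := by
    have h1 : P.natDegree ≤ m * 1 := by
      refine Polynomial.natDegree_comp_le.trans ?_
      rw [descPochhammer_natDegree]
      exact Nat.mul_le_mul_left _ Polynomial.natDegree_linear_le
    omega
  have h := congrFun (Polynomial.fwdDiff_iter_eq_zero_of_degree_lt hP) 0
  rw [fwdDiff_iter_eq_sum_shift] at h
  rw [← show _ = (0 : ℝ) from h]
  apply sum_congr rfl
  intro t ht
  have : P.eval (0 + t • (1 : ℝ)) = ((2 * t + l).descFactorial m : ℝ) := by
    rw [← descPochhammer_eval_eq_descFactorial]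
    simp [P]
  rw [this]
  simp

lemma bD_diag (i : ℕ) : bD i i * bC i i = 1 := by
  unfold bD bC
  have h := Nat.factorial_mul_descFactorial (show i ≤ 2 * i + 1 by omega)
  rw [show 2 * i + 1 - i = i + 1 by omega, Nat.factorial_succ, Nat.factorial_succ] at h
  rw [show 2 * i - i = i by omega, Even.neg_one_pow ⟨i, rfl⟩, Nat.choose_self]
  have h' : ((i : ℝ) + 1) * i.factorial * ((2 * i + 1).descFactorial i : ℝ)
    = (2 * i + 1) * (2 * i).factorial := by exact_mod_cast h
  have := Nat.factorial_ne_zero (2 * i)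
  have : (2 * (i : ℝ) + 1) ≠ 0 := by positivity
  field_simp
  push_cast
  linear_combination h'

lemma desc_aux (m l t : ℕ) :
    ((2 * (l + t) + 1).descFactorial (l + m + 1) : ℝ) / (2 * (l + t) + 1) *
      ((2 * (l + t) - l).factorial / (2 * (l + t)).factorial)
      = ((2 * t + l).descFactorial m : ℝ) := by
  have h1 := Nat.succ_descFactorial_succ (2 * (l + t)) (l + m)
  have h2 := Nat.descFactorial_mul_descFactorial (n := 2 * (l + t)) (show l ≤ l + m by omega)
  have h3 := Nat.factorial_mul_descFactorial (show l ≤ 2 * (l + t) by omega)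
  rw [show 2 * (l + t) - l = 2 * t + l by omega, show l + m - l = m by omega] at h2
  rw [show 2 * (l + t) - l = 2 * t + l by omega] at h3 ⊢
  rw [h1, ← h2, ← h3]
  have := Nat.factorial_ne_zero (2 * t + l)
  have hd : ((2 * (l + t)).descFactorial l : ℝ) ≠ 0 := by
    intro h0
    have h0' : (2 * (l + t)).descFactorial l = 0 := by exact_mod_cast h0
    rw [Nat.descFactorial_eq_zero_iff_lt] at h0'
    omega
  have : (2 * ((l : ℝ) + t) + 1) ≠ 0 := by positivity
  push_cast
  field_simp

lemma bD_bC (n i l : ℕ) (hi : i ≤ n) :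
    ∑ k ∈ range (n + 1), bD i k * bC k l = if i = l then 1 else 0 := by
  have hz : ∀ k, (k < l ∨ i < k) → bD i k * bC k l = 0 := by
    rintro k (h | h)
    · simp [bC, Nat.choose_eq_zero_of_lt h]
    · simp [bD, Nat.choose_eq_zero_of_lt h]
  rcases lt_trichotomy i l with h | h | h
  · rw [if_neg h.ne]
    apply sum_eq_zero
    intro k _
    apply hz
    omega
  · subst h
    rw [if_pos rfl, sum_eq_single i, bD_diag]
    · intro k _ hk
      apply hz
      omega
    · intro h
      simp at h
      omega
  · rw [if_neg h.ne']
    obtain ⟨m, rfl⟩ := Nat.exists_eq_add_of_lt h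
    have hs : ∑ k ∈ range (n + 1), bD (l + m + 1) k * bC k l
        = ∑ k ∈ Ico l (l + (m + 2)), bD (l + m + 1) k * bC k l := by
      symm
      apply sum_subset
      · intro j hj
        simp only [mem_range, mem_Ico] at *
        omega
      · intro j hj hj'
        simp only [mem_range, mem_Ico] at *
        apply hz
        omega
    rw [hs, sum_Ico_eq_sum_range, show l + (m + 2) - l = m + 1 + 1 by omega]
    have := alt_sum m l
    rw [← mul_zero (((l + m + 1 : ℝ) + 1) / 2 ^ (m + 1) * (l + m + 1).choose l), ← this, mul_sum]
    apply sum_congr rfl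
    intro t ht
    simp only [mem_range] at ht
    rw [← desc_aux]
    have hc := Nat.choose_mul (n := l + m + 1) (show l ≤ l + t by omega)
    rw [show l + m + 1 - l = m + 1 by omega, show l + t - l = t by omega] at hc
    have hc' : ((l + m + 1).choose (l + t) : ℝ) * (l + t).choose l =
      (l + m + 1).choose l * (m + 1).choose t := by exact_mod_cast hc
    have hsgn : (-1 : ℝ) ^ (l + m + 1 + (l + t)) = (-1) ^ (m + 1 - t) := by
      rw [show l + m + 1 + (l + t) = (m + 1 - t) + 2 * (l + t) by omega, pow_add, pow_mul]
      simp
    unfold bD bC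
    rw [hsgn]
    have hp : (2 : ℝ) ^ (l + m + 1) = 2 ^ (m + 1) * 2 ^ l := by
      rw [← pow_add]; congr 1; omega
    rw [hp]
    have := Nat.factorial_ne_zero (2 * (l + t))
    have : (2 * ((l : ℝ) + t) + 1) ≠ 0 := by positivity
    push_cast
    field_simp
    linear_combination ((2 * (l + t) + 1).descFactorial (l + m + 1) : ℝ) * hc'

lemma beta_eq (n : ℕ) (a : ℝ) (β : ℕ → ℝ)
    (hβ : ∀ u : ℝ, besselQ n (a * u) * besselQ 0 ((1 - a) * u) =
      ∑ k ∈ Finset.range (n + 0 + 1), β k * besselQ k u) (k : ℕ) (hk : k ≤ n) :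
    β k = ∑ l ∈ range (n + 1), bC n l * a ^ l * bD l k := by
  have hcoef : ∀ l ≤ n, bC n l * a ^ l = ∑ k ∈ range (n + 1), β k * bC k l := by
    have hpoly : (∑ l ∈ range (n + 1), Polynomial.monomial l (bC n l * a ^ l)) =
        ∑ l ∈ range (n + 1), Polynomial.monomial l (∑ k ∈ range (n + 1), β k * bC k l) := by
      apply Polynomial.funext
      intro u
      have h := hβ u
      have h0 : ∀ v, besselQ 0 v = 1 := by intro v; simp [besselQ]
      rw [h0, mul_one, besselQ_eq n n le_rfl] at h
      simp only [Polynomial.eval_finsetSum, Polynomial.eval_monomial]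
      simp only [sum_mul]
      rw [sum_comm]
      calc _ = ∑ l ∈ range (n + 1), bC n l * (a * u) ^ l := by
            apply sum_congr rfl
            intro l _
            rw [mul_pow]; ring
        _ = _ := h
        _ = _ := by
            apply sum_congr rfl
            intro k hk
            simp only [mem_range] at hk
            rw [besselQ_eq n k (by omega), mul_sum]
            apply sum_congr rfl
            intro l _
            ring
    intro l hl
    have h := congrArg (fun p => Polynomial.coeff p l) hpoly
    simpa [Polynomial.finsetSum_coeff, Polynomial.coeff_monomial, Nat.lt_succ_of_le hl] using h
  let C : Matrix (Fin (n + 1)) (Fin (n + 1)) ℝ := fun i j => bC i j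
  let D : Matrix (Fin (n + 1)) (Fin (n + 1)) ℝ := fun i j => bD i j
  have hDC : D * C = 1 := by
    ext i l
    rw [Matrix.mul_apply, Matrix.one_apply]
    have := bD_bC n i l (by omega)
    rw [Finset.sum_range] at this
    simp only [Fin.ext_iff]
    exact this
  have hCD : C * D = 1 := mul_eq_one_comm.mp hDC
  let b : Fin (n + 1) → ℝ := fun i => β i
  have hv : Matrix.vecMul b C = fun l : Fin (n + 1) => bC n l * a ^ (l : ℕ) := by
    funext l
    rw [hcoef l (by omega), Finset.sum_range]
    rfl
  have hb : b = Matrix.vecMul (fun l : Fin (n + 1) => bC n l * a ^ (l : ℕ)) D := by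
    rw [← hv, Matrix.vecMul_vecMul, hCD, Matrix.vecMul_one]
  have := congrFun hb ⟨k, by omega⟩
  rw [Finset.sum_range]
  exact this

lemma term_conv (a : ℝ) (k m r : ℕ) (hr : r ≤ m + 1) :
    bC (k + m + 1) (k + r) * a ^ (k + r) * bD (k + r) k =
    a ^ k * ((k + m + 1).choose k : ℝ) * (2 * k).factorial / (k + 1).factorial /
      (2 * (k + m + 1)).factorial * (((m + 1).factorial : ℝ) * (k + m + 1).factorial) *
      ((-a) ^ r * ((k : ℝ) + 1 + r) * ((k + 1).choose r : ℝ) *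
      ((k + 1 + m + (m + 1) - r).choose (k + 1 + m) : ℝ)) := by
  have hc := Nat.choose_mul (n := k + m + 1) (show k ≤ k + r by omega)
  rw [show k + m + 1 - k = m + 1 by omega, show k + r - k = r by omega] at hc
  have hc' : ((k + m + 1).choose (k + r) : ℝ) * (k + r).choose k =
      (k + m + 1).choose k * (m + 1).choose r := by exact_mod_cast hc
  have hd := Nat.descFactorial_mul_descFactorial (n := 2 * k + 1) (show k ≤ k + r by omega)
  rw [show 2 * k + 1 - k = k + 1 by omega, show k + r - k = r by omega,
    Nat.descFactorial_eq_factorial_mul_choose (k + 1) r] at hd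
  have hf := Nat.factorial_mul_descFactorial (show k ≤ 2 * k + 1 by omega)
  rw [show 2 * k + 1 - k = k + 1 by omega, Nat.factorial_succ (2 * k)] at hf
  have hd' : ((2 * k + 1).descFactorial (k + r) : ℝ) = r.factorial * (k + 1).choose r *
      ((2 * k + 1) * (2 * k).factorial / (k + 1).factorial) := by
    have hf' : ((2 * (k : ℝ) + 1) * (2 * k).factorial / (k + 1).factorial)
        = (2 * k + 1).descFactorial k := by
      rw [div_eq_iff (by exact_mod_cast Nat.factorial_ne_zero _), mul_comm _ ((k + 1).factorial : ℝ)]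
      exact_mod_cast hf.symm
    rw [hf']
    exact_mod_cast hd.symm
  have g1 : ((m + 1).choose r : ℝ) = (m + 1).factorial / (r.factorial * (m + 1 - r).factorial) :=
    Nat.cast_choose ℝ hr
  have g2 : ((k + 1 + m + (m + 1) - r).choose (k + 1 + m) : ℝ) =
      (k + 1 + m + (m + 1) - r).factorial / ((k + m + 1).factorial * (m + 1 - r).factorial) := by
    rw [Nat.cast_choose ℝ (by omega), show k + 1 + m + (m + 1) - r - (k + 1 + m) = m + 1 - r by omega,
      show k + 1 + m = k + m + 1 by omega]
  have hsgn : (-1 : ℝ) ^ (k + r + k) = (-1) ^ r := by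
    rw [show k + r + k = r + 2 * k by omega, pow_add, pow_mul]
    simp
  unfold bC bD
  rw [g2, hsgn, hd', neg_pow a, show 2 * (k + m + 1) - (k + r) = k + 1 + m + (m + 1) - r by omega]
  have e : ((k + m + 1).choose (k + r) : ℝ) * (k + r).choose k =
      (k + m + 1).choose k * ((m + 1).factorial / (r.factorial * (m + 1 - r).factorial)) := by
    rw [hc', g1]
  have h1 : (r.factorial : ℝ) ≠ 0 := by exact_mod_cast Nat.factorial_ne_zero _
  have h2 : ((m + 1 - r).factorial : ℝ) ≠ 0 := by exact_mod_cast Nat.factorial_ne_zero _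
  have h3 : ((k + m + 1).factorial : ℝ) ≠ 0 := by exact_mod_cast Nat.factorial_ne_zero _
  have h4 : ((k + 1).factorial : ℝ) ≠ 0 := by exact_mod_cast Nat.factorial_ne_zero _
  have h5 : ((2 * (k + m + 1)).factorial : ℝ) ≠ 0 := by exact_mod_cast Nat.factorial_ne_zero _
  have h6 : (2 * (k : ℝ) + 1) ≠ 0 := by positivity
  generalize ((k + m + 1).choose (k + r) : ℝ) = X1 at *
  generalize ((k + r).choose k : ℝ) = X2 at *
  generalize ((k + m + 1).choose k : ℝ) = X3 at *
  generalize ((r.factorial : ℝ)) = X4 at *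
  generalize ((m + 1 - r).factorial : ℝ) = X5 at *
  generalize ((m + 1).factorial : ℝ) = X6 at *
  generalize ((k + m + 1).factorial : ℝ) = X7 at *
  generalize ((k + 1).factorial : ℝ) = X8 at *
  generalize ((2 * (k + m + 1)).factorial : ℝ) = X9 at *
  field_simp at e
  push_cast
  rw [pow_add a, pow_add (2 : ℝ)]
  field_simp
  linear_combination ((k : ℝ) + r + 1) * a ^ k * a ^ r * ((k + 1).choose r : ℝ) * e

theorem bessel_linearization_boundary_case
    (n : ℕ) (a : ℝ) (β : ℕ → ℝ)
    (hβ : ∀ u : ℝ, besselQ n (a * u) * besselQ 0 ((1 - a) * u) =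
      ∑ k ∈ Finset.range (n + 0 + 1), β k * besselQ k u) :
    β n = a ^ n ∧
    ∀ k : ℕ, k < n →
      β k = a ^ k * (1 - a) * ((n.choose k : ℝ) / ((2 * n).choose (2 * k))) *
        ∑ j ∈ Finset.range (min (n - k - 1) k + 1),
          ((n + 1).choose (k - j) : ℝ) * ((n - k - 1).choose j) * (1 - a) ^ j := by
  have hz : ∀ l k, l < k → bD l k = 0 := by
    intro l k h
    simp [bD, Nat.choose_eq_zero_of_lt h]
  constructor
  · rw [beta_eq n a β hβ n le_rfl, sum_range_succ, sum_eq_zero]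
    · linear_combination a ^ n * bD_diag n
    · intro l hl
      rw [hz l n (by simpa using hl), mul_zero]
  · intro k hk
    rw [beta_eq n a β hβ k hk.le]
    obtain ⟨m, rfl⟩ := Nat.exists_eq_add_of_lt hk
    have hs : ∑ l ∈ range (k + m + 1 + 1), bC (k + m + 1) l * a ^ l * bD l k
        = ∑ l ∈ Ico k (k + m + 1 + 1), bC (k + m + 1) l * a ^ l * bD l k := by
      symm
      apply sum_subset
      · intro j hj
        simp only [mem_range, mem_Ico] at *
        omega
      · intro j hj hj'
        simp only [mem_range, mem_Ico] at *
        rw [hz j k (by omega), mul_zero]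
    rw [hs, sum_Ico_eq_sum_range, show k + m + 1 + 1 - k = m + 2 by omega,
      show k + m + 1 - k - 1 = m by omega]
    rw [sum_congr rfl (fun r hr => term_conv a k m r (by simp only [mem_range] at hr; omega)),
      ← mul_sum, mul_assoc (_ / _) _ (Finset.sum _ _), key_sum]
    rw [Nat.cast_choose ℝ (show 2 * k ≤ 2 * (k + m + 1) by omega),
      show 2 * (k + m + 1) - 2 * k = 2 * (m + 1) by omega]
    have h4 : ((k + 1).factorial : ℝ) ≠ 0 := by exact_mod_cast Nat.factorial_ne_zero _
    have h5 : ((2 * (k + m + 1)).factorial : ℝ) ≠ 0 := by exact_mod_cast Nat.factorial_ne_zero _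
    have h6 : ((2 * k).factorial : ℝ) ≠ 0 := by exact_mod_cast Nat.factorial_ne_zero _
    have h7 : ((2 * (m + 1)).factorial : ℝ) ≠ 0 := by exact_mod_cast Nat.factorial_ne_zero _
    field_simp
end
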